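/- arXiv:math/0209251 — 3 statements merged into one kernel-verified Lean document; each statement's English description precedes it below -/
import Mathlib

section
/- Let (R,m,K)→(S,n,L) be a flat local homomorphism of F-finite reduced Noetherian local rings of prime characteristic p whose closed fiber S/mS is Gorenstein. Write the injective hull E_R(K) as a direct limit lim_t R/J_t of cyclic modules along a nested sequence of irreducible m-primary ideals J_t, with elements u_t ∈ R representing the socle generator of E_R(K) and u_t ↦ u_{t+1}. Assume that 0 is Frobenius closed in E_R(K), i.e., whenever u ∈ E_R(K) is represented by {u'_t} and u'_t{}^q ∈ J_t^[q] for some q and t, then u = 0. If S/mS is F-rational and c ∈ S − mS, then there exists q such that the inclusion S c^{1/q} ⊆ S^{1/q} splits as a map of S-modules. -/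
open IsLocalRing

/-- The Frobenius power `I^[q]` of an ideal: the ideal generated by the `q`-th powers
of the elements of `I`. -/
def Ideal.frobPow {R : Type*} [CommRing R] (I : Ideal R) (q : ℕ) : Ideal R :=
  Ideal.span ((fun x : R => x ^ q) '' (I : Set R))

/-- `R°`: the complement in `R` of the union of the minimal primes of `R`. -/
def circComplement (R : Type*) [CommRing R] : Set R :=
  {c : R | ∀ P ∈ minimalPrimes R, c ∉ P}

/-- `x ∈ I*`: tight closure membership (`p` is the characteristic). -/
def MemTightClosure {R : Type*} [CommRing R] (p : ℕ) (I : Ideal R) (x : R) : Prop :=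
  ∃ c ∈ circComplement R, ∃ N : ℕ, ∀ e : ℕ, N ≤ e → c * x ^ p ^ e ∈ I.frobPow (p ^ e)

/-- An ideal is tightly closed if `I* = I`. -/
def Ideal.IsTightlyClosed {R : Type*} [CommRing R] (p : ℕ) (I : Ideal R) : Prop :=
  ∀ x : R, MemTightClosure p I x → x ∈ I

/-- An ideal is Frobenius closed if `x^q ∈ I^[q]` for some `q` implies `x ∈ I`. -/
def Ideal.IsFrobeniusClosed {R : Type*} [CommRing R] (p : ℕ) (I : Ideal R) : Prop :=
  ∀ x : R, (∃ e : ℕ, x ^ p ^ e ∈ I.frobPow (p ^ e)) → x ∈ I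

/-- A ring is weakly F-regular if every ideal is tightly closed. -/
def IsWeaklyFRegular (R : Type*) [CommRing R] (p : ℕ) : Prop :=
  ∀ I : Ideal R, I.IsTightlyClosed p

/-- A test element: an element of `R°` that works in every tight closure test. -/
def IsTestElement {R : Type*} [CommRing R] (p : ℕ) (c : R) : Prop :=
  c ∈ circComplement R ∧
    ∀ (I : Ideal R) (x : R), MemTightClosure p I x → ∀ e : ℕ, c * x ^ p ^ e ∈ I.frobPow (p ^ e)

/-- A (full) system of parameters of a local ring: `dim R` elements of the maximal
ideal generating an ideal whose radical is the maximal ideal. -/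
def IsSystemOfParameters (R : Type*) [CommRing R] [IsLocalRing R] {n : ℕ} (x : Fin n → R) : Prop :=
  ringKrullDim R = n ∧ (∀ i, x i ∈ maximalIdeal R) ∧
    maximalIdeal R ≤ (Ideal.span (Set.range x)).radical

/-- A parameter ideal: an ideal generated by part of a system of parameters. -/
def Ideal.IsParameterIdeal {R : Type*} [CommRing R] [IsLocalRing R] (I : Ideal R) : Prop :=
  ∃ (n k : ℕ) (h : k ≤ n) (x : Fin n → R), IsSystemOfParameters R x ∧
    I = Ideal.span (Set.range fun i : Fin k => x (Fin.castLE h i))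

/-- A local ring is F-rational if every parameter ideal is tightly closed. -/
def IsFRational (R : Type*) [CommRing R] [IsLocalRing R] (p : ℕ) : Prop :=
  ∀ I : Ideal R, I.IsParameterIdeal → I.IsTightlyClosed p

/-- A local ring is F-injective if every parameter ideal is Frobenius closed. -/
def IsFInjective (R : Type*) [CommRing R] [IsLocalRing R] (p : ℕ) : Prop :=
  ∀ I : Ideal R, I.IsParameterIdeal → I.IsFrobeniusClosed p

/-- A local ring is Cohen-Macaulay if some system of parameters is a regular sequence. -/
def IsCohenMacaulayLocalRing (R : Type*) [CommRing R] [IsLocalRing R] : Prop :=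
  ∃ (n : ℕ) (x : Fin n → R), IsSystemOfParameters R x ∧
    RingTheory.Sequence.IsRegular R (List.ofFn x)

/-- An irreducible ideal: a proper ideal that is not the intersection of two
strictly larger ideals. -/
def Ideal.IsIrreducible {R : Type*} [CommRing R] (I : Ideal R) : Prop :=
  I ≠ ⊤ ∧ ∀ A B : Ideal R, I = A ⊓ B → I = A ∨ I = B

/-- A local ring is Gorenstein if it is Cohen-Macaulay and some system of parameters
generates an irreducible ideal. -/
def IsGorensteinLocalRing (R : Type*) [CommRing R] [IsLocalRing R] : Prop :=
  ∃ (n : ℕ) (x : Fin n → R), IsSystemOfParameters R x ∧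
    RingTheory.Sequence.IsRegular R (List.ofFn x) ∧
    (Ideal.span (Set.range x)).IsIrreducible

/-- The inclusion `R·c^{1/q} ⊆ R^{1/q}` (with `q = p^e`) splits over `R`: identifying
`R^{1/q}` with `R` via `x^{1/q} ↦ x`, this says there is an additive map `θ : R → R`
which is `R`-linear for the `q`-th power action and sends `c` to `1`. -/
def FrobSplits {R : Type*} [CommRing R] (p : ℕ) (c : R) (e : ℕ) : Prop :=
  ∃ θ : R →+ R, (∀ a x : R, θ (a ^ p ^ e * x) = a * θ x) ∧ θ c = 1

/-- A reduced ring of characteristic `p` is F-finite if `R^{1/p}` is a finitely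
generated `R`-module, i.e. `R` is finitely generated over its subring of `p`-th powers. -/
def IsFFinite (R : Type*) [CommRing R] (p : ℕ) : Prop :=
  ∃ s : Finset R, ∀ x : R, ∃ a : R → R, x = ∑ i ∈ s, a i ^ p * i

/-- An F-finite reduced ring is strongly F-regular if for every `c ∈ R°` there is a `q`
such that `R·c^{1/q} ⊆ R^{1/q}` splits over `R`. -/
def IsStronglyFRegular (R : Type*) [CommRing R] (p : ℕ) : Prop :=
  ∀ c ∈ circComplement R, ∃ e : ℕ, FrobSplits p c e

/-- The socle `(I :_R m)/I` of `R ⧸ I` is one-dimensional over the residue field,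
with (the image of) `u` as a generator. -/
def GeneratesSocle {R : Type*} [CommRing R] [IsLocalRing R] (I : Ideal R) (u : R) : Prop :=
  u ∈ Submodule.colon I (maximalIdeal R) ∧ u ∉ I ∧
    ∀ v ∈ Submodule.colon I (maximalIdeal R), ∃ r : R, v - r * u ∈ I

/-- `dim_K ((I :_R m)/I) = 1`: the socle of `R ⧸ I` is one-dimensional over the
residue field. -/
def SocleDimOne {R : Type*} [CommRing R] [IsLocalRing R] (I : Ideal R) : Prop :=
  ∃ u : R, GeneratesSocle I u


theorem Ideal.mem_sup_span_singleton_iff {R : Type*} [CommRing R] {I : Ideal R} {x y : R} :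
    y ∈ I ⊔ Ideal.span {x} ↔ ∃ r : R, y - r * x ∈ I := by
  rw [Submodule.mem_sup]
  constructor
  · rintro ⟨a, ha, b, hb, rfl⟩
    obtain ⟨r, rfl⟩ := Ideal.mem_span_singleton'.mp hb
    exact ⟨r, by simpa using ha⟩
  · rintro ⟨r, hr⟩
    exact ⟨_, hr, r * x, Ideal.mem_span_singleton'.mpr ⟨r, rfl⟩, by ring⟩

theorem generatesSocle_iff {R : Type*} [CommRing R] [IsLocalRing R] {I : Ideal R} {u : R} :
    GeneratesSocle I u ↔ (∀ a ∈ maximalIdeal R, u * a ∈ I) ∧ u ∉ I ∧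
      ∀ v, (∀ a ∈ maximalIdeal R, v * a ∈ I) → v ∈ I ⊔ Ideal.span {u} := by
  simp only [GeneratesSocle, Submodule.mem_colon, SetLike.mem_coe, smul_eq_mul,
    Ideal.mem_sup_span_singleton_iff]

/-- `x` is a nonzerodivisor modulo the ideal `I`. -/
def RegularMod {R : Type*} [CommRing R] (I : Ideal R) (x : R) : Prop :=
  ∀ y : R, x * y ∈ I → y ∈ I

namespace RegularMod

variable {R : Type*} [CommRing R] {I : Ideal R} {x y : R}

theorem pow (h : RegularMod I x) (k : ℕ) : RegularMod I (x ^ k) := by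
  induction k with
  | zero => intro y hy; simpa using hy
  | succ k ih =>
    intro y hy
    exact ih y (h _ (by rwa [pow_succ', mul_assoc] at hy))

/-- If `x` is regular modulo `I`, then `(I + (x^(k+l))) : x^k = I + (x^l)`. -/
theorem mem_of_pow_mul_mem (h : RegularMod I x) (k l : ℕ)
    (hy : x ^ k * y ∈ I ⊔ Ideal.span {x ^ (k + l)}) : y ∈ I ⊔ Ideal.span {x ^ l} := by
  rw [Ideal.mem_sup_span_singleton_iff] at hy ⊢
  obtain ⟨r, hr⟩ := hy
  refine ⟨r, h.pow k _ ?_⟩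
  rwa [show x ^ k * (y - r * x ^ l) = x ^ k * y - r * x ^ (k + l) by ring]

theorem sup_span_pow (hx : RegularMod I x) (hy : RegularMod (I ⊔ Ideal.span {x}) y) (k : ℕ) :
    RegularMod (I ⊔ Ideal.span {x ^ k}) y := by
  induction k with
  | zero => intro z _; simp
  | succ k ih =>
    intro z hz
    obtain ⟨r, hr⟩ := Ideal.mem_sup_span_singleton_iff.mp
      (ih z (sup_le_sup_left (Ideal.span_singleton_le_span_singleton.mpr
        (pow_dvd_pow x k.le_succ)) I hz))
    have h1 : x ^ k * (y * r) ∈ I ⊔ Ideal.span {x ^ (k + 1)} := by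
      have h2 : y * (z - r * x ^ k) ∈ I ⊔ Ideal.span {x ^ (k + 1)} :=
        Ideal.mul_mem_left _ _ (Ideal.mem_sup_left hr)
      convert sub_mem hz h2 using 1
      ring
    have h3 := hx.mem_of_pow_mul_mem k 1 h1
    rw [pow_one] at h3
    obtain ⟨s, hs⟩ := Ideal.mem_sup_span_singleton_iff.mp (hy r h3)
    rw [Ideal.mem_sup_span_singleton_iff]
    refine ⟨s, ?_⟩
    convert add_mem hr (Ideal.mul_mem_right (x ^ k) _ hs) using 1
    ring

end RegularMod

theorem GeneratesSocle.sup_span_pow {R : Type*} [CommRing R] [IsLocalRing R] {I : Ideal R}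
    {x b : R} (h : GeneratesSocle (I ⊔ Ideal.span {x}) b) (hx : RegularMod I x)
    (hxm : x ∈ maximalIdeal R) (k : ℕ) :
    GeneratesSocle (I ⊔ Ideal.span {x ^ (k + 1)}) (b * x ^ k) := by
  rw [generatesSocle_iff] at h ⊢
  obtain ⟨h1, h2, h3⟩ := h
  have hmul : ∀ a ∈ I ⊔ Ideal.span {x}, a * x ^ k ∈ I ⊔ Ideal.span {x ^ (k + 1)} := by
    intro a ha
    rw [Ideal.mem_sup_span_singleton_iff] at ha ⊢
    obtain ⟨r, hr⟩ := ha
    refine ⟨r, ?_⟩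
    convert Ideal.mul_mem_right (x ^ k) _ hr using 1
    ring
  have hdiv : ∀ a, a * x ^ k ∈ I ⊔ Ideal.span {x ^ (k + 1)} → a ∈ I ⊔ Ideal.span {x} := by
    intro a ha
    have := hx.mem_of_pow_mul_mem (y := a) k 1 (by rwa [mul_comm])
    rwa [pow_one] at this
  refine ⟨fun a ha ↦ ?_, fun h ↦ h2 (hdiv b h), fun v hv ↦ ?_⟩
  · rw [mul_right_comm]
    exact hmul _ (h1 a ha)
  · have h4 : v ∈ I ⊔ Ideal.span {x ^ k} :=
      hx.mem_of_pow_mul_mem 1 k (by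
        rw [pow_one, mul_comm, add_comm 1 k]; exact hv x hxm)
    obtain ⟨r, hr⟩ := Ideal.mem_sup_span_singleton_iff.mp h4
    have h5 : r ∈ I ⊔ Ideal.span {x} ⊔ Ideal.span {b} := by
      refine h3 r fun a ha ↦ hdiv _ ?_
      have h6 : (v - r * x ^ k) * a ∈ I ⊔ Ideal.span {x ^ (k + 1)} :=
        Ideal.mul_mem_right _ _ (Ideal.mem_sup_left hr)
      convert sub_mem (hv a ha) h6 using 1
      ring
    obtain ⟨s, hs⟩ := Ideal.mem_sup_span_singleton_iff.mp h5
    refine Ideal.mem_sup_span_singleton_iff.mpr ⟨s, ?_⟩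
    convert add_mem (Ideal.mem_sup_left hr) (hmul _ hs) using 1
    ring

/-- The family `x` is a regular sequence modulo `I` in every order. -/
def PermRegularMod {R ι : Type*} [CommRing R] (I : Ideal R) (x : ι → R) : Prop :=
  ∀ (s : Finset ι), ∀ i ∉ s, RegularMod (I ⊔ Ideal.span (x '' s)) (x i)

theorem sup_span_image_insert {R ι : Type*} [CommRing R] [DecidableEq ι] (I : Ideal R) (x : ι → R)
    (s : Finset ι) (i : ι) :
    I ⊔ Ideal.span (x '' (insert i s : Finset ι)) =
      I ⊔ Ideal.span (x '' s) ⊔ Ideal.span {x i} := by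
  rw [Finset.coe_insert, Set.image_insert_eq, Ideal.span_insert, sup_assoc,
    sup_comm (Ideal.span {x i})]

namespace PermRegularMod

variable {R ι : Type*} [CommRing R] {I : Ideal R} {x : ι → R}

theorem mixed (h : PermRegularMod I x) (k : ℕ) (s : Finset ι) : ∀ (t : Finset ι), Disjoint s t →
    ∀ i ∉ s, i ∉ t →
      RegularMod (I ⊔ Ideal.span (x '' t) ⊔ Ideal.span ((fun j ↦ x j ^ k) '' s)) (x i) := by
  classical
  induction s using Finset.induction_on with
  | empty => intro t _ i _ hi; simpa using h t i hi
  | insert j s hj ih =>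
    intro t hst i his hit
    rw [Finset.disjoint_insert_left] at hst
    rw [Finset.mem_insert, not_or] at his
    rw [sup_span_image_insert]
    refine (ih t hst.2 j hj hst.1).sup_span_pow ?_ k
    have := ih (insert j t) (Finset.disjoint_insert_right.mpr ⟨hj, hst.2⟩) i his.2
      (by simp [his.1, hit])
    rwa [sup_span_image_insert, sup_right_comm] at this

theorem pow (h : PermRegularMod I x) (k : ℕ) : PermRegularMod I (fun j ↦ x j ^ k) := by
  intro s i hi
  have := h.mixed k s ∅ (by simp) i hi (by simp)
  simpa using this.pow k

theorem generatesSocle_pow [IsLocalRing R] [Fintype ι] (h : PermRegularMod I x)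
    (hx : ∀ i, x i ∈ maximalIdeal R) {b : R}
    (hb : GeneratesSocle (I ⊔ Ideal.span (Set.range x)) b) (k : ℕ) :
    GeneratesSocle (I ⊔ Ideal.span (Set.range fun j ↦ x j ^ (k + 1))) (b * ∏ j, x j ^ k) := by
  classical
  have key : ∀ s : Finset ι, GeneratesSocle
      (I ⊔ Ideal.span (x '' (sᶜ : Finset ι)) ⊔ Ideal.span ((fun j ↦ x j ^ (k + 1)) '' s))
      (b * ∏ j ∈ s, x j ^ k) := by
    intro s
    induction s using Finset.induction_on with
    | empty => simpa using hb
    | insert j s hj ih =>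
      have h1 : sᶜ = insert j (insert j s)ᶜ := by
        ext i; by_cases hij : i = j <;> simp [hij, hj]
      rw [h1, sup_span_image_insert, sup_right_comm] at ih
      rw [sup_span_image_insert, Finset.prod_insert hj, mul_comm (x j ^ k), ← mul_assoc]
      refine ih.sup_span_pow (h.mixed (k + 1) s _ ?_ j hj (by simp)) (hx j) k
      rw [Finset.disjoint_right]
      intro i hi his
      simp [his] at hi
  simpa using key Finset.univ

theorem mem_of_mul_prod_mem [Fintype ι] (h : PermRegularMod I x) (k : ℕ) {y : R}
    (hy : y * ∏ j, x j ^ k ∈ I ⊔ Ideal.span (Set.range fun j ↦ x j ^ (k + 1))) :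
    y ∈ I ⊔ Ideal.span (Set.range x) := by
  classical
  have key : ∀ s : Finset ι, ∀ y, y * ∏ j ∈ s, x j ^ k ∈
      (I ⊔ Ideal.span (x '' (sᶜ : Finset ι)) ⊔ Ideal.span ((fun j ↦ x j ^ (k + 1)) '' s)) →
      y ∈ I ⊔ Ideal.span (Set.range x) := by
    intro s
    induction s using Finset.induction_on with
    | empty => intro y hy; simpa using hy
    | insert j s hj ih =>
      intro y hy
      have h1 : sᶜ = insert j (insert j s)ᶜ := by
        ext i; by_cases hij : i = j <;> simp [hij, hj]
      refine ih y ?_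
      rw [h1, sup_span_image_insert, sup_right_comm]
      rw [sup_span_image_insert, Finset.prod_insert hj, mul_left_comm] at hy
      have := (h.mixed (k + 1) s (insert j s)ᶜ ?_ j hj (by simp)).mem_of_pow_mul_mem k 1 hy
      · rwa [pow_one] at this
      · rw [Finset.disjoint_right]
        intro i hi his
        simp [his] at hi
  exact key Finset.univ y (by simpa using hy)

end PermRegularMod

theorem Ideal.exists_mem_notMem_socle {R : Type*} [CommRing R] [IsNoetherianRing R] [IsLocalRing R]
    {I L : Ideal R} (hI : maximalIdeal R ≤ I.radical) (hL : ¬ L ≤ I) :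
    ∃ b ∈ L, b ∉ I ∧ ∀ a ∈ maximalIdeal R, b * a ∈ I := by
  classical
  have hex : ∃ N, maximalIdeal R ^ N * L ≤ I := by
    obtain ⟨N, hN⟩ := Ideal.exists_pow_le_of_le_radical_of_fg hI
      (IsNoetherian.noetherian (maximalIdeal R))
    exact ⟨N, Ideal.mul_le_left.trans hN⟩
  obtain ⟨N, hN, hmin⟩ : ∃ N, maximalIdeal R ^ N * L ≤ I ∧ ∀ M < N, ¬ maximalIdeal R ^ M * L ≤ I :=
    ⟨Nat.find hex, Nat.find_spec hex, fun M hM ↦ Nat.find_min hex hM⟩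
  cases N with
  | zero => simp [hL] at hN
  | succ N =>
    obtain ⟨b, hb, hbI⟩ := SetLike.not_le_iff_exists.mp (hmin N N.lt_succ_self)
    refine ⟨b, Ideal.mul_le_right hb, hbI, fun a ha ↦ hN ?_⟩
    rw [pow_succ', mul_assoc, mul_comm b]
    exact Ideal.mul_mem_mul ha hb

/-- `S ⧸ 𝔞` behaves like a flat `R`-module with respect to `m`-primary ideals `J` of `R`:
`J(S ⧸ 𝔞) : u = (J : u)(S ⧸ 𝔞)`. -/
def FlatMod (R : Type*) {S : Type*} [CommRing R] [CommRing S] [IsLocalRing R] [Algebra R S]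
    (𝔞 : Ideal S) : Prop :=
  ∀ J : Ideal R, maximalIdeal R ≤ J.radical → ∀ (u : R) (x : S),
    x * algebraMap R S u ∈ J.map (algebraMap R S) ⊔ 𝔞 →
      x ∈ (Submodule.colon J {u}).map (algebraMap R S) ⊔ 𝔞

section

variable {R S : Type*} [CommRing R] [CommRing S] [Algebra R S]

theorem Ideal.mul_algebraMap_mem_map_sup {K J : Ideal R} {u : R} (h : ∀ k ∈ K, k * u ∈ J)
    {𝔞 : Ideal S} {y : S} (hy : y ∈ K.map (algebraMap R S) ⊔ 𝔞) :
    y * algebraMap R S u ∈ J.map (algebraMap R S) ⊔ 𝔞 := by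
  obtain ⟨k, hk, a, ha, rfl⟩ := Submodule.mem_sup.mp hy
  rw [add_mul]
  refine add_mem (Ideal.mem_sup_left ?_) (Ideal.mem_sup_right (Ideal.mul_mem_right _ _ ha))
  have h1 : K * Ideal.span {u} ≤ J := by
    rw [Ideal.mul_le]
    intro r hr s hs
    obtain ⟨t, rfl⟩ := Ideal.mem_span_singleton'.mp hs
    rw [mul_left_comm]
    exact J.mul_mem_left _ (h r hr)
  refine Ideal.map_mono h1 ?_
  rw [Ideal.map_mul]
  exact Ideal.mul_mem_mul hk (Ideal.mem_map_of_mem _ (Ideal.mem_span_singleton_self u))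

theorem Ideal.mem_map_sup_span_sup_iff {J : Ideal R} {u : R} {𝔞 : Ideal S} {x : S} :
    x ∈ (J ⊔ Ideal.span {u}).map (algebraMap R S) ⊔ 𝔞 ↔
      ∃ s : S, x - s * algebraMap R S u ∈ J.map (algebraMap R S) ⊔ 𝔞 := by
  rw [Ideal.map_sup, Ideal.map_span, Set.image_singleton, sup_right_comm,
    Ideal.mem_sup_span_singleton_iff]

namespace FlatMod

variable [IsLocalRing R] {𝔞 : Ideal S}

theorem bot [Module.Flat R S] : FlatMod R (⊥ : Ideal S) := by
  intro J _ u x hx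
  rw [sup_bot_eq] at hx ⊢
  obtain ⟨n, g, s, hg⟩ : ∃ (n : ℕ) (g : Fin n → J) (s : Fin n → S),
      x * algebraMap R S u = ∑ i, s i * algebraMap R S (g i) := by
    rw [Ideal.map, ← Ideal.submodule_span_eq, Submodule.mem_span_set'] at hx
    obtain ⟨n, f, g, hfg⟩ := hx
    choose g' hg' hg'' using fun i ↦ (g i).2
    refine ⟨n, fun i ↦ ⟨g' i, hg' i⟩, f, ?_⟩
    simp [← hfg, hg'']
  have hrel : ∑ i : Option (Fin n), (i.elim u fun j ↦ -(g j : R)) • (i.elim x s) = 0 := by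
    rw [Fintype.sum_option]
    simp only [Option.elim_none, Option.elim_some, Algebra.smul_def, map_neg, neg_mul,
      Finset.sum_neg_distrib, mul_comm (algebraMap R S _), hg, add_neg_cancel]
  obtain ⟨k, a, y, h1, h2⟩ := Module.Flat.isTrivialRelation_of_sum_smul_eq_zero
    (R := R) (M := S) (f := fun i : Option (Fin n) ↦ i.elim u fun j ↦ -(g j : R))
    (x := fun i ↦ i.elim x s) hrel
  have h3 := h1 none
  simp only [Option.elim_none] at h3
  rw [h3]
  refine sum_mem fun j _ ↦ ?_
  rw [Algebra.smul_def]
  refine Ideal.mul_mem_right _ _ (Ideal.mem_map_of_mem _ ?_)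
  rw [Submodule.mem_colon_singleton, smul_eq_mul]
  have h4 := h2 j
  rw [Fintype.sum_option] at h4
  simp only [Option.elim_none, Option.elim_some, neg_mul, Finset.sum_neg_distrib] at h4
  rw [mul_comm, add_neg_eq_zero.mp h4]
  exact sum_mem fun i _ ↦ J.mul_mem_right _ (g i).2

theorem regularMod [IsNoetherianRing R] (h : FlatMod R 𝔞) {z : S}
    (hz : RegularMod ((maximalIdeal R).map (algebraMap R S) ⊔ 𝔞) z) (J : Ideal R)
    (hJ : maximalIdeal R ≤ J.radical) : RegularMod (J.map (algebraMap R S) ⊔ 𝔞) z := by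
  induction J using WellFoundedGT.induction with
  | ind J ih =>
  by_cases hJtop : J = ⊤
  · intro y _
    simp [hJtop, Ideal.map_top]
  obtain ⟨u, -, huJ, hu⟩ := Ideal.exists_mem_notMem_socle (L := ⊤) hJ (by simpa using hJtop)
  intro x hx
  have hlt : J < J ⊔ Ideal.span {u} := by
    refine lt_of_le_of_ne le_sup_left fun he ↦ huJ ?_
    rw [he]
    exact Ideal.mem_sup_right (Ideal.mem_span_singleton_self u)
  have h1 := ih _ hlt (hJ.trans (Ideal.radical_mono le_sup_left)) x
    (sup_le_sup_right (Ideal.map_mono le_sup_left) 𝔞 hx)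
  obtain ⟨y, hy⟩ := Ideal.mem_map_sup_span_sup_iff.mp h1
  have h2 : z * y * algebraMap R S u ∈ J.map (algebraMap R S) ⊔ 𝔞 := by
    convert sub_mem hx (Ideal.mul_mem_left _ z hy) using 1
    ring
  have h3 : Submodule.colon J {u} ≤ maximalIdeal R := by
    refine le_maximalIdeal fun htop ↦ huJ ?_
    have : (1 : R) ∈ Submodule.colon J {u} := htop ▸ Submodule.mem_top
    simpa using Submodule.mem_colon_singleton.mp this
  have h4 := hz y (sup_le_sup_right (Ideal.map_mono h3) 𝔞 (h J hJ u _ h2))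
  have h5 := Ideal.mul_algebraMap_mem_map_sup (fun k hk ↦ mul_comm u k ▸ hu k hk) h4
  convert add_mem hy h5 using 1
  ring

theorem sup_span_singleton [IsNoetherianRing R] (h : FlatMod R 𝔞) {z : S}
    (hz : RegularMod ((maximalIdeal R).map (algebraMap R S) ⊔ 𝔞) z) :
    FlatMod R (𝔞 ⊔ Ideal.span {z}) := by
  intro J hJ u x hx
  rw [← sup_assoc, Ideal.mem_sup_span_singleton_iff] at hx ⊢
  obtain ⟨y, hy⟩ := hx
  have h1 : z * y ∈ (J ⊔ Ideal.span {u}).map (algebraMap R S) ⊔ 𝔞 := by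
    refine Ideal.mem_map_sup_span_sup_iff.mpr ⟨x, ?_⟩
    convert neg_mem hy using 1
    ring
  obtain ⟨y', hy'⟩ := Ideal.mem_map_sup_span_sup_iff.mp
    (h.regularMod hz _ (hJ.trans (Ideal.radical_mono le_sup_left)) y h1)
  refine ⟨y', h J hJ u _ ?_⟩
  convert add_mem hy (Ideal.mul_mem_right z _ hy') using 1
  ring

theorem of_permRegularMod [IsNoetherianRing R] [Module.Flat R S] {ι : Type*} [Fintype ι]
    {z : ι → S} (hz : PermRegularMod ((maximalIdeal R).map (algebraMap R S)) z) :
    FlatMod R (Ideal.span (Set.range z)) := by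
  classical
  have key : ∀ s : Finset ι, FlatMod R (Ideal.span (z '' s)) := by
    intro s
    induction s using Finset.induction_on with
    | empty => simpa using FlatMod.bot
    | insert i s hi ih =>
      have := sup_span_image_insert ⊥ z s i
      rw [bot_sup_eq, bot_sup_eq] at this
      rw [this]
      exact ih.sup_span_singleton (hz s i hi)
  simpa using key Finset.univ

theorem mem_inf_map (h : FlatMod R 𝔞) {J₁ : Ideal R} (h₁ : maximalIdeal R ≤ J₁.radical)
    (s : Finset R) (x : S) (hx₁ : x ∈ J₁.map (algebraMap R S) ⊔ 𝔞)
    (hx₂ : x ∈ (Ideal.span (s : Set R)).map (algebraMap R S) ⊔ 𝔞) :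
    x ∈ (J₁ ⊓ Ideal.span (s : Set R)).map (algebraMap R S) ⊔ 𝔞 := by
  classical
  induction s using Finset.induction_on generalizing x with
  | empty =>
    refine sup_le_sup_right (Ideal.map_mono ?_) 𝔞 hx₂
    simp
  | insert u s _ ih =>
    rw [Finset.coe_insert, Ideal.span_insert, sup_comm (Ideal.span {u})] at hx₂ ⊢
    generalize Ideal.span (s : Set R) = K at ih hx₂ ⊢
    obtain ⟨y, hy⟩ := Ideal.mem_map_sup_span_sup_iff.mp hx₂
    have h2 : y * algebraMap R S u ∈ (J₁ ⊔ K).map (algebraMap R S) ⊔ 𝔞 := by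
      have h3 := sup_le_sup_right (Ideal.map_mono (f := algebraMap R S)
        (le_sup_left : J₁ ≤ J₁ ⊔ K)) 𝔞 hx₁
      have h4 := sup_le_sup_right (Ideal.map_mono (f := algebraMap R S)
        (le_sup_right : K ≤ J₁ ⊔ K)) 𝔞 hy
      convert sub_mem h3 h4 using 1
      ring
    have h3 := h _ (h₁.trans (Ideal.radical_mono le_sup_left)) u y h2
    have h4 : ∀ k ∈ Submodule.colon (J₁ ⊔ K) {u}, k * u ∈ J₁ ⊓ (K ⊔ Ideal.span {u}) ⊔ K := by
      intro k hk
      obtain ⟨j, hj, a, ha, hja⟩ := Submodule.mem_sup.mp (Submodule.mem_colon_singleton.mp hk)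
      rw [← smul_eq_mul, ← hja]
      refine add_mem (Ideal.mem_sup_left ⟨hj, ?_⟩) (Ideal.mem_sup_right ha)
      rw [SetLike.mem_coe, eq_sub_of_add_eq hja]
      have h5 : k • u ∈ K ⊔ Ideal.span {u} :=
        Ideal.mem_sup_right (Ideal.mul_mem_left _ k (Ideal.mem_span_singleton_self u))
      exact sub_mem h5 (Ideal.mem_sup_left ha)
    have h5 := Ideal.mul_algebraMap_mem_map_sup h4 h3
    have h6 : x ∈ (J₁ ⊓ (K ⊔ Ideal.span {u}) ⊔ K).map (algebraMap R S) ⊔ 𝔞 := by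
      have h7 := sup_le_sup_right (Ideal.map_mono (f := algebraMap R S)
        (le_sup_right : K ≤ J₁ ⊓ (K ⊔ Ideal.span {u}) ⊔ K)) 𝔞 hy
      convert add_mem h5 h7 using 1
      ring
    rw [Ideal.map_sup, sup_assoc] at h6
    obtain ⟨w, hw, x', hx', rfl⟩ := Submodule.mem_sup.mp h6
    refine add_mem (Ideal.mem_sup_left hw) ?_
    refine sup_le_sup_right (Ideal.map_mono (inf_le_inf_left J₁ le_sup_left)) 𝔞
      (ih x' ?_ hx')
    have h7 : w ∈ J₁.map (algebraMap R S) ⊔ 𝔞 :=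
      Ideal.mem_sup_left (Ideal.map_mono inf_le_left hw)
    simpa using sub_mem hx₁ h7

theorem mem_colon_finset_map [IsNoetherianRing R] (h : FlatMod R 𝔞) {J : Ideal R}
    (hJ : maximalIdeal R ≤ J.radical) (s : Finset R) (x : S)
    (hx : ∀ a ∈ s, x * algebraMap R S a ∈ J.map (algebraMap R S) ⊔ 𝔞) :
    x ∈ (Submodule.colon J (s : Set R)).map (algebraMap R S) ⊔ 𝔞 := by
  classical
  induction s using Finset.induction_on with
  | empty => simp [Ideal.map_top]
  | insert a s _ ih =>
    rw [Finset.coe_insert, Set.insert_eq, Submodule.colon_union]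
    obtain ⟨t, ht⟩ := IsNoetherian.noetherian (Submodule.colon J (s : Set R))
    rw [← ht, Ideal.submodule_span_eq]
    refine h.mem_inf_map ?_ t x (h J hJ a x (hx a (Finset.mem_insert_self a s))) ?_
    · exact hJ.trans (Ideal.radical_mono Ideal.le_colon)
    · rw [← Ideal.submodule_span_eq, ht]
      exact ih fun b hb ↦ hx b (Finset.mem_insert_of_mem hb)

theorem generatesSocle [IsNoetherianRing R] [IsLocalRing S] [IsLocalHom (algebraMap R S)]
    (h : FlatMod R 𝔞) {J : Ideal R} (hJ : maximalIdeal R ≤ J.radical) {u : R}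
    (hu : GeneratesSocle J u) {v : S}
    (hv : GeneratesSocle ((maximalIdeal R).map (algebraMap R S) ⊔ 𝔞) v) :
    GeneratesSocle (J.map (algebraMap R S) ⊔ 𝔞) (v * algebraMap R S u) := by
  rw [generatesSocle_iff] at hu hv ⊢
  obtain ⟨hu1, hu2, hu3⟩ := hu
  obtain ⟨hv1, hv2, hv3⟩ := hv
  have hcolon : Submodule.colon J {u} ≤ maximalIdeal R := by
    refine le_maximalIdeal fun htop ↦ hu2 ?_
    have : (1 : R) ∈ Submodule.colon J {u} := htop ▸ Submodule.mem_top
    simpa using Submodule.mem_colon_singleton.mp this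
  have hdiv : ∀ x, x * algebraMap R S u ∈ J.map (algebraMap R S) ⊔ 𝔞 →
      x ∈ (maximalIdeal R).map (algebraMap R S) ⊔ 𝔞 := fun x hx ↦
    sup_le_sup_right (Ideal.map_mono hcolon) 𝔞 (h J hJ u x hx)
  have hmul : ∀ x ∈ (maximalIdeal R).map (algebraMap R S) ⊔ 𝔞,
      x * algebraMap R S u ∈ J.map (algebraMap R S) ⊔ 𝔞 := fun x hx ↦
    Ideal.mul_algebraMap_mem_map_sup (fun k hk ↦ mul_comm u k ▸ hu1 k hk) hx
  refine ⟨fun a ha ↦ ?_, fun hmem ↦ hv2 (hdiv v hmem), fun w hw ↦ ?_⟩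
  · rw [mul_right_comm]
    exact hmul _ (hv1 a ha)
  · obtain ⟨t, ht⟩ := IsNoetherian.noetherian (maximalIdeal R)
    have h1 : w ∈ (Submodule.colon J (t : Set R)).map (algebraMap R S) ⊔ 𝔞 := by
      refine h.mem_colon_finset_map hJ t w fun a ha ↦ hw _ ?_
      have ha' : a ∈ maximalIdeal R := ht ▸ Submodule.subset_span ha
      exact map_mem_nonunits_iff (algebraMap R S) a |>.mpr ha'
    have h2 : Submodule.colon J (t : Set R) ≤ J ⊔ Ideal.span {u} := by
      intro r hr
      refine hu3 r fun a ha ↦ ?_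
      rw [← ht] at ha
      have : Submodule.span R (t : Set R) ≤ Submodule.colon J {r} := by
        refine Submodule.span_le.mpr fun b hb ↦ ?_
        have := Submodule.mem_colon.mp hr b hb
        rw [SetLike.mem_coe, Submodule.mem_colon_singleton]
        rwa [smul_eq_mul, mul_comm]
      have := Submodule.mem_colon_singleton.mp (this ha)
      rwa [smul_eq_mul, mul_comm] at this
    obtain ⟨s, hs⟩ := Ideal.mem_map_sup_span_sup_iff.mp
      (sup_le_sup_right (Ideal.map_mono h2) 𝔞 h1)
    have h3 : s ∈ (maximalIdeal R).map (algebraMap R S) ⊔ 𝔞 ⊔ Ideal.span {v} := by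
      refine hv3 s fun a ha ↦ hdiv _ ?_
      convert sub_mem (hw a ha) (Ideal.mul_mem_right a _ hs) using 1
      ring
    obtain ⟨r, hr⟩ := Ideal.mem_sup_span_singleton_iff.mp h3
    refine Ideal.mem_sup_span_singleton_iff.mpr ⟨r, ?_⟩
    convert add_mem hs (hmul _ hr) using 1
    ring

end FlatMod

end

theorem Ideal.Quotient.mk_mem_maximalIdeal_iff {S : Type*} [CommRing S] [IsLocalRing S]
    {I : Ideal S} [IsLocalRing (S ⧸ I)] {a : S} :
    Ideal.Quotient.mk I a ∈ maximalIdeal (S ⧸ I) ↔ a ∈ maximalIdeal S := by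
  have := IsLocalHom.of_surjective (Ideal.Quotient.mk I) Ideal.Quotient.mk_surjective
  exact map_mem_nonunits_iff (Ideal.Quotient.mk I) a

theorem generatesSocle_map_mk_iff {S : Type*} [CommRing S] [IsLocalRing S] {I K : Ideal S}
    [IsLocalRing (S ⧸ I)] {b : S} :
    GeneratesSocle (K.map (Ideal.Quotient.mk I)) (Ideal.Quotient.mk I b) ↔
      GeneratesSocle (I ⊔ K) b := by
  have hspan : K.map (Ideal.Quotient.mk I) ⊔ Ideal.span {Ideal.Quotient.mk I b} =
      (K ⊔ Ideal.span {b}).map (Ideal.Quotient.mk I) := by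
    rw [Ideal.map_sup, Ideal.map_span, Set.image_singleton]
  have hmem : ∀ (L : Ideal S) (y : S), Ideal.Quotient.mk I y ∈ L.map (Ideal.Quotient.mk I) ↔
      y ∈ I ⊔ L := fun L y ↦ by rw [Ideal.mem_quotient_iff_mem_sup, sup_comm]
  simp only [generatesSocle_iff, hspan, Ideal.Quotient.mk_surjective.forall,
    Ideal.Quotient.mk_mem_maximalIdeal_iff, ← map_mul, hmem, sup_assoc]

theorem PermRegularMod.of_quotient {S ι : Type*} [CommRing S] {I : Ideal S} {z : ι → S}
    (h : PermRegularMod (⊥ : Ideal (S ⧸ I)) fun i ↦ Ideal.Quotient.mk I (z i)) :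
    PermRegularMod I z := by
  have hmem : ∀ (s : Finset ι) (y : S), Ideal.Quotient.mk I y ∈
      (⊥ : Ideal (S ⧸ I)) ⊔ Ideal.span ((fun i ↦ Ideal.Quotient.mk I (z i)) '' s) ↔
      y ∈ I ⊔ Ideal.span (z '' s) := fun s y ↦ by
    rw [bot_sup_eq, sup_comm, ← Ideal.mem_quotient_iff_mem_sup, Ideal.map_span, Set.image_image]
  intro s i hi y hy
  rw [← hmem] at hy ⊢
  exact h s i hi _ hy

theorem PermRegularMod.of_isWeaklyRegular {A : Type*} [CommRing A] [IsNoetherianRing A]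
    [IsLocalRing A] {n : ℕ} {x : Fin n → A}
    (h : RingTheory.Sequence.IsWeaklyRegular A (List.ofFn x))
    (hx : ∀ i, x i ∈ maximalIdeal A) : PermRegularMod ⊥ x := by
  classical
  intro s i hi y hy
  let t : Finset (Fin n) := (insert i s)ᶜ
  have hperm : (List.finRange n).Perm (s.toList ++ i :: t.toList) := by
    refine (List.perm_ext_iff_of_nodup (List.nodup_finRange n) ?_).mpr fun j ↦ ?_
    · simp [List.nodup_append, Finset.nodup_toList, t]
      grind
    · simp [t]
      tauto
  have h1 := IsLocalRing.isWeaklyRegular_of_perm_of_subset_maximalIdeal h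
    (rs' := s.toList.map x ++ x i :: t.toList.map x)
    (by rw [List.ofFn_eq_map, ← List.map_cons, ← List.map_append]; exact hperm.map x)
    (fun r hr ↦ by obtain ⟨j, rfl⟩ := List.mem_ofFn.mp hr; exact hx j)
  have h2 := ((RingTheory.Sequence.isWeaklyRegular_cons_iff _ _ _).mp
    ((RingTheory.Sequence.isWeaklyRegular_append_iff _ _ _).mp h1).2).1
  have h3 : Ideal.ofList (s.toList.map x) • (⊤ : Submodule A A) =
      (⊥ ⊔ Ideal.span (x '' s) : Ideal A) := by
    rw [bot_sup_eq, smul_eq_mul, Ideal.mul_top, Ideal.ofList]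
    congr 1
    ext a
    simp
  rw [h3] at h2
  have h4 := h2 (a₁ := Submodule.Quotient.mk y) (a₂ := 0)
    (by simpa only [smul_zero, ← Submodule.Quotient.mk_smul, Submodule.Quotient.mk_eq_zero,
      smul_eq_mul] using hy)
  exact (Submodule.Quotient.mk_eq_zero _).mp h4

theorem Ideal.IsIrreducible.exists_generatesSocle {A : Type*} [CommRing A] [IsNoetherianRing A]
    [IsLocalRing A] {I : Ideal A} (h : I.IsIrreducible) (hI : maximalIdeal A ≤ I.radical) :
    ∃ b, GeneratesSocle I b := by
  obtain ⟨b, -, hbI, hb⟩ := Ideal.exists_mem_notMem_socle hI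
    (fun h' ↦ h.1 (top_le_iff.mp h') : ¬ ⊤ ≤ I)
  refine ⟨b, generatesSocle_iff.mpr ⟨hb, hbI, fun v hv ↦ ?_⟩⟩
  by_contra hvb
  have hinf : I = (I ⊔ Ideal.span {b}) ⊓ (I ⊔ Ideal.span {v}) := by
    refine le_antisymm (le_inf le_sup_left le_sup_left) ?_
    rintro y ⟨hy₁, hy₂⟩
    obtain ⟨r, hr⟩ := Ideal.mem_sup_span_singleton_iff.mp hy₁
    obtain ⟨s, hs⟩ := Ideal.mem_sup_span_singleton_iff.mp hy₂
    by_cases hsu : IsUnit s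
    · refine (hvb ?_).elim
      rw [← Ideal.unit_mul_mem_iff_mem _ hsu]
      have := sub_mem hy₁ (Ideal.mem_sup_left hs)
      rwa [sub_sub_cancel] at this
    · have := add_mem hs (hv s hsu)
      rwa [mul_comm v, sub_add_cancel] at this
  rcases h.2 _ _ hinf with h' | h'
  · exact hbI (h' ▸ Ideal.mem_sup_right (Ideal.mem_span_singleton_self b))
  · exact hvb (Ideal.mem_sup_left (h' ▸ Ideal.mem_sup_right (Ideal.mem_span_singleton_self v)))

theorem Module.length_le_add_of_exact {R M N P : Type*} [Ring R] [AddCommGroup M] [AddCommGroup N]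
    [AddCommGroup P] [Module R M] [Module R N] [Module R P] (f : M →ₗ[R] N) (g : N →ₗ[R] P)
    (h : Function.Exact f g) : Module.length R N ≤ Module.length R M + Module.length R P := by
  rw [Module.length_eq_add_of_exact (LinearMap.ker g).subtype g.rangeRestrict
    (Submodule.subtype_injective _) g.surjective_rangeRestrict
    (LinearMap.exact_iff.mpr (by simp))]
  refine add_le_add ?_ (Module.length_le_of_injective _ (Submodule.subtype_injective _))
  refine Module.length_le_of_surjective (f.codRestrict (LinearMap.ker g) fun x ↦ ?_) ?_
  · exact LinearMap.mem_ker.mpr (h.apply_apply_eq_zero x)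
  · rintro ⟨y, hy⟩
    obtain ⟨x, rfl⟩ := (h y).mp hy
    exact ⟨x, rfl⟩

section

variable {B : Type*} [CommRing B] [IsLocalRing B] {w : B}

theorem GeneratesSocle.length_hom_le_of_isSimpleModule (hw : GeneratesSocle (⊥ : Ideal B) w)
    (K : Type*) [AddCommGroup K] [Module B K] [IsSimpleModule B K] :
    Module.length B (K →ₗ[B] B) ≤ 1 := by
  obtain ⟨h1, -, h3⟩ := generatesSocle_iff.mp hw
  simp only [Ideal.mem_bot, bot_sup_eq] at h1 h3
  obtain ⟨I, hI, ⟨e⟩⟩ := isSimpleModule_iff_quot_maximal.mp ‹IsSimpleModule B K›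
  obtain rfl := eq_maximalIdeal hI
  let g : K := e.symm (Submodule.Quotient.mk 1)
  have hg : ∀ x : K, ∃ b : B, x = b • g := by
    intro x
    obtain ⟨b, hb⟩ := Submodule.Quotient.mk_surjective _ (e x)
    refine ⟨b, ?_⟩
    rw [← map_smul, ← Submodule.Quotient.mk_smul, smul_eq_mul, mul_one, hb, e.symm_apply_apply]
  have hgm : ∀ a ∈ maximalIdeal B, a • g = 0 := by
    intro a ha
    rw [← map_smul, ← Submodule.Quotient.mk_smul, smul_eq_mul, mul_one,
      (Submodule.Quotient.mk_eq_zero _).mpr ha, map_zero]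
  have hmem : ∀ φ : K →ₗ[B] B, LinearMap.applyₗ g φ ∈ Ideal.span {w} := by
    intro φ
    refine h3 _ fun a ha ↦ ?_
    rw [LinearMap.applyₗ_apply_apply, mul_comm, ← smul_eq_mul, ← map_smul, hgm a ha, map_zero]
  have hinj : Function.Injective ((LinearMap.applyₗ g).codRestrict (Ideal.span {w}) hmem) := by
    intro φ ψ hφψ
    have h4 : φ g = ψ g := congrArg Subtype.val hφψ
    ext x
    obtain ⟨b, rfl⟩ := hg x
    rw [map_smul, map_smul, h4]
  refine (Module.length_le_of_injective _ hinj).trans ?_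
  have hker : maximalIdeal B ≤ LinearMap.ker (LinearMap.toSpanSingleton B B w) := by
    intro a ha
    rw [LinearMap.mem_ker, LinearMap.toSpanSingleton_apply, smul_eq_mul, mul_comm, h1 a ha]
  have hmem' : ∀ x, (maximalIdeal B).liftQ _ hker x ∈ Ideal.span {w} := by
    intro x
    obtain ⟨b, rfl⟩ := Submodule.Quotient.mk_surjective _ x
    exact Ideal.mem_span_singleton'.mpr ⟨b, rfl⟩
  have hsurj : Function.Surjective
      (((maximalIdeal B).liftQ _ hker).codRestrict (Ideal.span {w}) hmem') := by
    rintro ⟨x, hx⟩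
    obtain ⟨b, rfl⟩ := Ideal.mem_span_singleton'.mp hx
    exact ⟨Submodule.Quotient.mk b, rfl⟩
  have hs : IsSimpleModule B (B ⧸ maximalIdeal B) :=
    isSimpleModule_iff_isCoatom.mpr (Ideal.isMaximal_def.mp inferInstance)
  exact (Module.length_le_of_surjective _ hsurj).trans (Module.length_eq_one B _).le

theorem GeneratesSocle.length_hom_le (hw : GeneratesSocle (⊥ : Ideal B) w)
    {M : Type*} [AddCommGroup M] [Module B M] (hM : IsFiniteLength B M) :
    Module.length B (M →ₗ[B] B) ≤ Module.length B M := by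
  induction hM with
  | of_subsingleton =>
    rw [Module.length_eq_zero]
    exact zero_le
  | @of_simple_quotient M _ _ N _ _ ih =>
    have hex : Function.Exact (LinearMap.lcomp B B N.mkQ) (LinearMap.lcomp B B N.subtype) := by
      intro φ
      constructor
      · intro hφ
        refine ⟨N.liftQ φ fun x hx ↦ LinearMap.congr_fun hφ ⟨x, hx⟩, ?_⟩
        ext x
        rfl
      · rintro ⟨ψ, rfl⟩
        ext x
        simp [(Submodule.Quotient.mk_eq_zero N).mpr x.2]
    rw [Module.length_eq_add_of_exact N.subtype N.mkQ N.subtype_injective N.mkQ_surjective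
      (LinearMap.exact_subtype_mkQ N), add_comm, Module.length_eq_one B (M ⧸ N)]
    exact (Module.length_le_add_of_exact _ _ hex).trans
      (add_le_add (hw.length_hom_le_of_isSimpleModule _) ih)

/-- An Artinian local ring with a one-dimensional socle is self-injective. -/
theorem GeneratesSocle.baer [IsArtinianRing B] (hw : GeneratesSocle (⊥ : Ideal B) w) :
    Module.Baer B B := by
  have hfl : ∀ (M : Type _) [AddCommGroup M] [Module B M] [Module.Finite B M],
      IsFiniteLength B M := fun M _ _ _ ↦
    isFiniteLength_iff_isNoetherian_isArtinian.mpr ⟨inferInstance, inferInstance⟩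
  rw [Module.Baer.iff_surjective]
  intro I
  set r := LinearMap.lcomp B B I.subtype
  have hI := hw.length_hom_le (hfl I)
  have hQ := hw.length_hom_le (hfl (B ⧸ I))
  have hIfin := Module.length_ne_top_iff.mpr (hfl I)
  have hQfin := Module.length_ne_top_iff.mpr (hfl (B ⧸ I))
  have hHom : IsFiniteLength B (I →ₗ[B] B) :=
    Module.length_ne_top_iff.mp (ne_top_of_le_ne_top hIfin hI)
  obtain ⟨_, _⟩ := isFiniteLength_iff_isNoetherian_isArtinian.mp hHom
  have hB := Module.length_eq_add_of_exact I.subtype I.mkQ I.subtype_injective I.mkQ_surjective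
      (LinearMap.exact_subtype_mkQ I)
  rw [← (LinearMap.ringLmapEquivSelf B B B).length_eq] at hB
  have hex : Function.Exact (LinearMap.lcomp B B I.mkQ) r.rangeRestrict := by
    intro φ
    constructor
    · intro hφ
      refine ⟨I.liftQ φ fun x hx ↦ LinearMap.congr_fun (congrArg Subtype.val hφ) ⟨x, hx⟩, ?_⟩
      ext
      rfl
    · rintro ⟨ψ, rfl⟩
      ext x
      simp [r, Ideal.Quotient.eq_zero_iff_mem.mpr x.2]
  have hle := (Module.length_le_add_of_exact (R := B) (M := B ⧸ I →ₗ[B] B) (N := B →ₗ[B] B)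
    (P := LinearMap.range r) (LinearMap.lcomp B B I.mkQ) r.rangeRestrict hex).trans
    (add_le_add_left hQ _)
  rw [hB, add_comm] at hle
  have hrange : Module.length B (I →ₗ[B] B) ≤ Module.length B (LinearMap.range r) :=
    hI.trans ((ENat.add_le_add_iff_left hQfin).mp hle)
  rw [← LinearMap.range_eq_top]
  by_contra hne
  exact (Submodule.length_lt hne).not_ge hrange

end

theorem GeneratesSocle.mem_of_le_of_not_le {R : Type*} [CommRing R] [IsNoetherianRing R]
    [IsLocalRing R] {I L : Ideal R} {w : R} (hw : GeneratesSocle I w)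
    (hI : maximalIdeal R ≤ I.radical) (hIL : I ≤ L) (hL : ¬ L ≤ I) : w ∈ L := by
  obtain ⟨b, hbL, hbI, hb⟩ := Ideal.exists_mem_notMem_socle hI hL
  obtain ⟨h1, -, h3⟩ := generatesSocle_iff.mp hw
  obtain ⟨r, hr⟩ := Ideal.mem_sup_span_singleton_iff.mp (h3 b hb)
  have hru : IsUnit r := by
    by_contra hru
    refine hbI ?_
    have := add_mem hr (h1 r hru)
    rwa [mul_comm w, sub_add_cancel] at this
  rw [← Ideal.unit_mul_mem_iff_mem L hru]
  have := sub_mem hbL (hIL hr)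
  rwa [sub_sub_cancel] at this

section

variable {S M : Type*} [CommRing S] [IsNoetherianRing S] [IsLocalRing S] [AddCommGroup M]
  [Module S M]

theorem GeneratesSocle.exists_linearMap_quotient_eq_one {I : Ideal S} {w : S}
    (hw : GeneratesSocle I w) (hI : maximalIdeal S ≤ I.radical) {m : M}
    (hm : w • m ∉ I • (⊤ : Submodule S M)) : ∃ g : M →ₗ[S] S ⧸ I, g m = 1 := by
  have hItop : I ≠ ⊤ := fun h ↦ hw.2.1 (h ▸ Submodule.mem_top)
  have : Nontrivial (S ⧸ I) := Ideal.Quotient.nontrivial_iff.mpr hItop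
  have : IsLocalRing (S ⧸ I) := .of_surjective' _ Ideal.Quotient.mk_surjective
  have hart : IsArtinianRing (S ⧸ I) := by
    rw [isArtinianRing_iff_isNilpotent_maximalIdeal]
    obtain ⟨N, hN⟩ := Ideal.exists_pow_le_of_le_radical_of_fg hI
      (IsNoetherian.noetherian (maximalIdeal S))
    refine ⟨N, ?_⟩
    have hmap : maximalIdeal (S ⧸ I) = (maximalIdeal S).map (Ideal.Quotient.mk I) := by
      ext x
      obtain ⟨a, rfl⟩ := Ideal.Quotient.mk_surjective x
      rw [Ideal.Quotient.mk_mem_maximalIdeal_iff, Ideal.mem_quotient_iff_mem]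
      exact le_maximalIdeal hItop
    rw [hmap, ← Ideal.map_pow, Ideal.zero_eq_bot, Ideal.map_eq_bot_iff_le_ker,
      Ideal.mk_ker]
    exact hN
  have hsoc : GeneratesSocle (⊥ : Ideal (S ⧸ I)) (Ideal.Quotient.mk I w) := by
    rwa [← Ideal.map_bot (f := Ideal.Quotient.mk I), generatesSocle_map_mk_iff, sup_bot_eq]
  let Q := M ⧸ (I • (⊤ : Submodule S M))
  let f : (S ⧸ I) →ₗ[S ⧸ I] Q := LinearMap.toSpanSingleton (S ⧸ I) Q (Submodule.Quotient.mk m)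
  have hf : ∀ s : S, f (Ideal.Quotient.mk I s) = Submodule.Quotient.mk (s • m) := fun s ↦ rfl
  have hfinj : Function.Injective f := by
    rw [← LinearMap.ker_eq_bot, eq_bot_iff]
    let L : Ideal S := Ideal.comap (Ideal.Quotient.mk I) (LinearMap.ker f)
    have hmemL : ∀ s, s ∈ L ↔ s • m ∈ I • (⊤ : Submodule S M) := by
      intro s
      rw [Ideal.mem_comap, LinearMap.mem_ker, hf, Submodule.Quotient.mk_eq_zero]
    have hLI : L ≤ I := by
      by_contra hL
      exact hm ((hmemL w).mp (hw.mem_of_le_of_not_le hI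
        (fun s hs ↦ (hmemL s).mpr (Submodule.smul_mem_smul hs Submodule.mem_top)) hL))
    intro x hx
    obtain ⟨s, rfl⟩ := Ideal.Quotient.mk_surjective x
    exact Ideal.Quotient.eq_zero_iff_mem.mpr (hLI hx)
  obtain ⟨h, hh⟩ := hsoc.baer.extension_property f hfinj LinearMap.id
  refine ⟨(h.restrictScalars S).comp (I • (⊤ : Submodule S M)).mkQ, ?_⟩
  have h5 := LinearMap.congr_fun hh 1
  rw [LinearMap.comp_apply, ← map_one (Ideal.Quotient.mk I), hf, one_smul] at h5
  exact h5

/-- A linear functional on a finite module over a Noetherian local ring taking the value `1` at `m`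
exists as soon as such functionals exist modulo arbitrarily small ideals. -/
theorem exists_dual_eq_one [Module.Finite S M] (m : M)
    (h : ∀ N : ℕ, ∃ I ≤ maximalIdeal S ^ N, ∃ g : M →ₗ[S] S ⧸ I, g m = 1) :
    ∃ φ : M →ₗ[S] S, φ m = 1 := by
  obtain ⟨n, π, hπ⟩ := Module.Finite.exists_fin' S M
  obtain ⟨a, k, hk⟩ := Submodule.fg_iff_exists_fin_generating_family.mp
    (IsNoetherian.noetherian (LinearMap.ker π))
  obtain ⟨c, rfl⟩ := hπ m
  let F := Fin n → S
  let Ψ : (F →ₗ[S] S) →ₗ[S] ((Fin a → S) × S) :=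
    (LinearMap.pi fun j ↦ LinearMap.applyₗ (k j)).prod (LinearMap.applyₗ c)
  suffices hmem : ((0, 1) : (Fin a → S) × S) ∈ LinearMap.range Ψ by
    obtain ⟨φ, hφ⟩ := hmem
    have hker : LinearMap.ker π ≤ LinearMap.ker φ := by
      rw [← hk, Submodule.span_le]
      rintro _ ⟨j, rfl⟩
      exact congrFun (congrArg Prod.fst hφ) j
    refine ⟨(LinearMap.ker π).liftQ φ hker ∘ₗ (π.quotKerEquivOfSurjective hπ).symm, ?_⟩
    have : (π.quotKerEquivOfSurjective hπ).symm (π c) = Submodule.Quotient.mk c := by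
      rw [LinearEquiv.symm_apply_eq]
      rfl
    rw [LinearMap.comp_apply, LinearEquiv.coe_coe, this]
    exact congrArg Prod.snd hφ
  rw [← Submodule.Quotient.mk_eq_zero, ← Submodule.mem_bot S,
    ← Ideal.iInf_pow_smul_eq_bot_of_isLocalRing (maximalIdeal S) Ideal.IsPrime.ne_top',
    Submodule.mem_iInf]
  intro N
  obtain ⟨I, hI, g, hg⟩ := h N
  obtain ⟨φ, hφ⟩ := Module.projective_lifting_property I.mkQ (g ∘ₗ π) I.mkQ_surjective
  have hφ' : ∀ x, Ideal.Quotient.mk I (φ x) = g (π x) := LinearMap.congr_fun hφ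
  have hsmul : ((0, 1) : (Fin a → S) × S) - Ψ φ ∈
      maximalIdeal S ^ N • (⊤ : Submodule S ((Fin a → S) × S)) := by
    have hfst : ∀ j, -φ (k j) ∈ maximalIdeal S ^ N := fun j ↦ by
      have hkj : k j ∈ LinearMap.ker π := hk ▸ Submodule.subset_span ⟨j, rfl⟩
      refine neg_mem (hI (Ideal.Quotient.eq_zero_iff_mem.mp ?_))
      rw [hφ', LinearMap.mem_ker.mp hkj, map_zero]
    have hsnd : 1 - φ c ∈ maximalIdeal S ^ N := by
      refine hI (Ideal.Quotient.eq_zero_iff_mem.mp ?_)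
      rw [map_sub, hφ', hg, map_one, sub_self]
    have hsum : ((0, 1) : (Fin a → S) × S) - Ψ φ =
        ∑ j, (-φ (k j)) • ((Pi.single j 1, 0) : (Fin a → S) × S) + (1 - φ c) • (0, 1) := by
      ext j
      · simp [Ψ, Prod.fst_sum, Finset.sum_apply, Pi.single_apply]
      · simp [Ψ, Prod.snd_sum]
    rw [hsum]
    exact add_mem (sum_mem fun j _ ↦ Submodule.smul_mem_smul (hfst j) Submodule.mem_top)
      (Submodule.smul_mem_smul hsnd Submodule.mem_top)
  have h7 := Submodule.mem_map_of_mem (f := (LinearMap.range Ψ).mkQ) hsmul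
  rw [Submodule.map_smul''] at h7
  have h8 : (LinearMap.range Ψ).mkQ ((0, 1) - Ψ φ) = Submodule.Quotient.mk (0, 1) := by
    rw [map_sub, sub_eq_self.mpr]
    · rfl
    · exact (Submodule.Quotient.mk_eq_zero _).mpr ⟨φ, rfl⟩
  rw [← h8]
  exact Submodule.smul_mono le_rfl le_top h7

end

section

variable {A : Type*} [CommRing A]

theorem isNilpotent_of_forall_mem_minimalPrimes {a : A} (h : ∀ P ∈ minimalPrimes A, a ∈ P) :
    IsNilpotent a := by
  rw [← mem_nilradical, nilradical, ← Ideal.sInf_minimalPrimes]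
  exact Ideal.mem_sInf.mpr fun {P} hP ↦ h P hP

theorem mem_nonZeroDivisors_of_mem_circComplement [IsReduced A] {d : A}
    (hd : d ∈ circComplement A) : d ∈ nonZeroDivisors A := by
  refine mem_nonZeroDivisors_iff_right.mpr fun a ha ↦ ?_
  refine (isNilpotent_of_forall_mem_minimalPrimes fun P hP ↦ ?_).eq_zero
  have := hP.1.1
  exact (this.mem_or_mem (ha ▸ P.zero_mem)).resolve_right (hd P hP)

/-- In a reduced Noetherian ring every element `c` has a complement `y` with `c * y = 0` lying in
exactly the minimal primes that do not contain `c`. -/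
theorem exists_mul_eq_zero_and_add_mem_circComplement [IsNoetherianRing A] [IsReduced A] (c : A) :
    ∃ y, c * y = 0 ∧ c + y ∈ circComplement A := by
  classical
  have hfin := minimalPrimes.finite_of_isNoetherianRing A
  let s := hfin.toFinset.filter (c ∈ ·)
  let t := hfin.toFinset.filter (c ∉ ·)
  have hs : ∀ P, P ∈ s ↔ P ∈ minimalPrimes A ∧ c ∈ P := by simp [s]
  have ht : ∀ P, P ∈ t ↔ P ∈ minimalPrimes A ∧ c ∉ P := by simp [t]
  have hnot : ¬ ((t.inf id : Ideal A) : Set A) ⊆ ⋃ P ∈ (s : Set (Ideal A)), (P : Ideal A) := by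
    rw [Ideal.subset_union_prime (f := fun P ↦ P) ⊥ ⊥ fun P hP _ _ ↦ ((hs P).mp hP).1.1.1]
    rintro ⟨P, hP, hle⟩
    have hP' := (hs P).mp hP
    obtain ⟨Q, hQ, hQP⟩ := (Ideal.IsPrime.inf_le' hP'.1.1.1).mp hle
    have hQ' := (ht Q).mp hQ
    exact hQ'.2 (hP'.1.2 hQ'.1.1 hQP hP'.2)
  obtain ⟨y, hyt, hys⟩ := Set.not_subset.mp hnot
  have hyt' : ∀ P ∈ minimalPrimes A, c ∉ P → y ∈ P := fun P hP hc ↦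
    Finset.inf_le (f := id) ((ht P).mpr ⟨hP, hc⟩) hyt
  have hys' : ∀ P ∈ minimalPrimes A, c ∈ P → y ∉ P := fun P hP hc hy ↦
    hys (Set.mem_biUnion ((hs P).mpr ⟨hP, hc⟩) hy)
  refine ⟨y, ?_, fun P hP hmem ↦ ?_⟩
  · refine (isNilpotent_of_forall_mem_minimalPrimes fun P hP ↦ ?_).eq_zero
    by_cases hc : c ∈ P
    · exact P.mul_mem_right _ hc
    · exact P.mul_mem_left _ (hyt' P hP hc)
  · by_cases hc : c ∈ P
    · exact hys' P hP hc ((P.add_mem_iff_right hc).mp hmem)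
    · exact hc ((P.add_mem_iff_left (hyt' P hP hc)).mp hmem)

variable [IsLocalRing A] {p : ℕ}

theorem IsSystemOfParameters.isParameterIdeal {n : ℕ} {x : Fin n → A}
    (hx : IsSystemOfParameters A x) : (Ideal.span (Set.range x)).IsParameterIdeal :=
  ⟨n, n, le_rfl, x, hx, rfl⟩

theorem IsSystemOfParameters.isParameterIdeal_bot {n : ℕ} {x : Fin n → A}
    (hx : IsSystemOfParameters A x) : (⊥ : Ideal A).IsParameterIdeal :=
  ⟨n, 0, n.zero_le, x, hx, by simp⟩

theorem one_mem_circComplement (A : Type*) [CommRing A] : (1 : A) ∈ circComplement A :=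
  fun _ hP h ↦ hP.1.1.ne_top ((Ideal.eq_top_iff_one _).mpr h)

theorem IsFRational.isReduced (hp : 1 < p) (h : IsFRational A p) {n : ℕ} {x : Fin n → A}
    (hx : IsSystemOfParameters A x) : IsReduced A := by
  refine ⟨fun a ⟨k, hk⟩ ↦ h _ hx.isParameterIdeal_bot a
    ⟨1, one_mem_circComplement A, k, fun e he ↦ ?_⟩⟩
  rw [one_mul, pow_eq_zero_of_le (he.trans (Nat.lt_pow_self hp).le) hk]
  exact zero_mem _

/-- A nonzerodivisor in the maximal ideal of a Noetherian local ring is a parameter. -/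
theorem isParameterIdeal_span_singleton [IsNoetherianRing A] {d : A} (hd : d ∈ nonZeroDivisors A)
    (hdm : d ∈ maximalIdeal A) : (Ideal.span {d}).IsParameterIdeal := by
  have hle : Ideal.span {d} ≤ maximalIdeal A := (Ideal.span_singleton_le_iff_mem _).mpr hdm
  have : Nontrivial (A ⧸ Ideal.span {d}) :=
    Ideal.Quotient.nontrivial_iff.mpr (ne_top_of_le_ne_top Ideal.IsPrime.ne_top' hle)
  have : IsLocalRing (A ⧸ Ideal.span {d}) := .of_surjective' _ Ideal.Quotient.mk_surjective
  obtain ⟨s, hs, hcard⟩ := Ideal.exists_finset_card_eq_height_of_isNoetherianRing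
    (maximalIdeal (A ⧸ Ideal.span {d}))
  have hdim := ringKrullDim_quotient_succ_le_of_nonZeroDivisor hd
  rw [← IsLocalRing.maximalIdeal_height_eq_ringKrullDim, ← hcard] at hdim
  let g : Fin s.card → A := fun i ↦ (Ideal.Quotient.mk_surjective (s.equivFin.symm i).1).choose
  have hg : ∀ i, Ideal.Quotient.mk (Ideal.span {d}) (g i) = s.equivFin.symm i := fun i ↦
    (Ideal.Quotient.mk_surjective (s.equivFin.symm i).1).choose_spec
  have hgs : (Ideal.span (Set.range g)).map (Ideal.Quotient.mk (Ideal.span {d})) =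
      Ideal.span s := by
    rw [Ideal.map_span, ← Set.range_comp]
    congr 1
    ext a
    constructor
    · rintro ⟨i, rfl⟩
      rw [Function.comp_apply, hg]
      exact (s.equivFin.symm i).2
    · intro ha
      exact ⟨s.equivFin ⟨a, ha⟩, by rw [Function.comp_apply, hg, Equiv.symm_apply_apply]⟩
  let w : Fin (s.card + 1) → A := Fin.cons d g
  have hwspan : Ideal.span (Set.range w) = Ideal.span (Set.range g) ⊔ Ideal.span {d} := by
    rw [Fin.range_cons, Ideal.span_insert, sup_comm]
  have hwm : ∀ i, w i ∈ maximalIdeal A := by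
    intro i
    refine Fin.cases hdm (fun i ↦ ?_) i
    change g i ∈ _
    rw [← Ideal.Quotient.mk_mem_maximalIdeal_iff (I := Ideal.span {d}), hg]
    exact hs.1.2 (Ideal.subset_span (s.equivFin.symm i).2)
  have hrad : maximalIdeal A ≤ (Ideal.span (Set.range w)).radical := by
    intro a ha
    have ha' : Ideal.Quotient.mk (Ideal.span {d}) a ∈ (Ideal.span (s : Set _)).radical := by
      rw [Ideal.radical_eq_sInf, Ideal.mem_sInf]
      rintro P ⟨hP, hP'⟩
      exact hs.2 ⟨hP', hP⟩ (le_maximalIdeal hP'.ne_top)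
        (Ideal.Quotient.mk_mem_maximalIdeal_iff.mpr ha)
    obtain ⟨j, hj⟩ := ha'
    refine ⟨j, ?_⟩
    rwa [hwspan, ← Ideal.mem_quotient_iff_mem_sup, hgs, map_pow]
  have hmin : maximalIdeal A ∈ (Ideal.span (Set.range w)).minimalPrimes := by
    refine ⟨⟨inferInstance, Ideal.span_le.mpr ?_⟩,
      fun P hP _ ↦ hrad.trans (hP.1.radical_le_iff.mpr hP.2)⟩
    rintro _ ⟨i, rfl⟩
    exact hwm i
  have hheight : (maximalIdeal A).height ≤ (s.card + 1 : ℕ) := by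
    refine (Ideal.height_le_card_of_mem_minimalPrimes_span (Set.finite_range w) hmin).trans ?_
    rw [Nat.cast_le, ← Set.image_univ]
    simpa [Set.ncard_univ] using Set.ncard_image_le (f := w) Set.finite_univ
  refine ⟨s.card + 1, 1, by simp, w, ⟨?_, hwm, hrad⟩, ?_⟩
  · refine le_antisymm ?_ (by exact_mod_cast hdim)
    rw [← IsLocalRing.maximalIdeal_height_eq_ringKrullDim]
    exact_mod_cast hheight
  · congr 1
    ext a
    simp [w, eq_comm]

/-- An F-rational local ring is a domain: every nonzero element lies outside all minimal primes. -/
theorem IsFRational.mem_circComplement [IsNoetherianRing A] (hp : 1 < p) (h : IsFRational A p)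
    {n : ℕ} {x : Fin n → A} (hx : IsSystemOfParameters A x) {c : A} (hc : c ≠ 0) :
    c ∈ circComplement A := by
  have := h.isReduced hp hx
  obtain ⟨y, hcy, hd⟩ := exists_mul_eq_zero_and_add_mem_circComplement c
  intro P hP hcP
  have hy : y ≠ 0 := by
    rintro rfl
    exact hd P hP (by simpa using hcP)
  by_cases hdu : IsUnit (c + y)
  · rcases isUnit_or_isUnit_of_isUnit_add hdu with hu | hu
    · exact hy ((hu.mul_right_eq_zero).mp hcy)
    · exact hc ((hu.mul_left_eq_zero).mp hcy)
  have hpow : ∀ k : ℕ, c * (c + y) ^ k = c ^ (k + 1) := by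
    intro k
    induction k with
    | zero => ring
    | succ k ih => linear_combination (c + y) * ih + c ^ k * hcy
  have hpow' : ∀ q ≠ 0, (c + y) * c ^ q = c * (c + y) ^ q := by
    intro q hq
    obtain ⟨k, rfl⟩ := Nat.exists_eq_add_one_of_ne_zero hq
    rw [hpow]
    linear_combination c ^ k * hcy
  obtain ⟨r, hr⟩ := Ideal.mem_span_singleton'.mp
    (h _ (isParameterIdeal_span_singleton (mem_nonZeroDivisors_of_mem_circComplement hd) hdu) c
      ⟨c + y, hd, 0, fun e _ ↦ by
        rw [hpow' _ (pow_ne_zero e (by lia))]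
        exact Ideal.mul_mem_left _ _ (Ideal.subset_span ⟨_, Ideal.mem_span_singleton_self _, rfl⟩)⟩)
  have hry : r * y ^ 2 = 0 := by
    linear_combination y * hr + (1 - r) * hcy
  have hrc : (1 - r) * c ^ 2 = 0 := by
    linear_combination - c * hr + r * hcy
  rcases isUnit_or_isUnit_one_sub_self r with hu | hu
  · exact hy (pow_eq_zero_iff two_ne_zero |>.mp (hu.mul_right_eq_zero.mp hry))
  · exact hc (pow_eq_zero_iff two_ne_zero |>.mp (hu.mul_right_eq_zero.mp hrc))

theorem IsFRational.exists_mul_pow_notMem [IsNoetherianRing A] (hp : 1 < p) (h : IsFRational A p)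
    {n : ℕ} {x : Fin n → A} (hx : IsSystemOfParameters A x) {c : A} (hc : c ≠ 0) {b : A}
    (hb : b ∉ Ideal.span (Set.range x)) :
    ∃ e : ℕ, c * b ^ p ^ e ∉ (Ideal.span (Set.range x)).frobPow (p ^ e) := by
  by_contra! hall
  exact hb (h _ hx.isParameterIdeal b ⟨c, h.mem_circComplement hp hx hc, 0, fun e _ ↦ hall e⟩)

end

theorem RingHom.Finite.of_forall_exists_eq_sum {S T : Type*} [CommRing S] [CommRing T]
    {f : S →+* T} (s : Finset T) (h : ∀ x, ∃ a : T → S, x = ∑ i ∈ s, f (a i) * i) : f.Finite := by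
  let := f.toAlgebra
  refine ⟨⟨s, eq_top_iff.mpr fun x _ ↦ ?_⟩⟩
  obtain ⟨a, rfl⟩ := h x
  exact sum_mem fun i hi ↦ Submodule.smul_mem _ (a i) (Submodule.subset_span hi)

theorem RingHom.exists_addMonoidHom_eq_one {S T : Type*} [CommRing S] [IsNoetherianRing S]
    [IsLocalRing S] [CommRing T] {f : S →+* T} (hf : f.Finite) (c : T)
    (h : ∀ N : ℕ, ∃ (I : Ideal S) (w : S), I ≤ maximalIdeal S ^ N ∧ maximalIdeal S ≤ I.radical ∧
      GeneratesSocle I w ∧ f w * c ∉ I.map f) :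
    ∃ θ : T →+ S, (∀ a x, θ (f a * x) = a * θ x) ∧ θ c = 1 := by
  algebraize [f]
  have key : ∃ φ : T →ₗ[S] S, φ c = 1 := by
    refine exists_dual_eq_one c fun N ↦ ?_
    obtain ⟨I, w, hIN, hI, hw, hwc⟩ := h N
    refine ⟨I, hIN, hw.exists_linearMap_quotient_eq_one hI ?_⟩
    rwa [Ideal.smul_top_eq_map, Submodule.restrictScalars_mem, Algebra.smul_def]
  obtain ⟨φ, hφ⟩ := key
  refine ⟨φ.toAddMonoidHom, fun a x ↦ ?_, hφ⟩
  exact φ.map_smul a x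

section

variable {S : Type*} [CommRing S] {p : ℕ} [Fact p.Prime] [CharP S p]

theorem IsFFinite.finite_iterateFrobenius (h : IsFFinite S p) (e : ℕ) :
    (iterateFrobenius S p e).Finite := by
  have hfrob : (frobenius S p).Finite := by
    obtain ⟨s, hs⟩ := h
    exact .of_forall_exists_eq_sum s hs
  induction e with
  | zero =>
    rw [iterateFrobenius_zero]
    exact RingHom.Finite.id S
  | succ e ih =>
    rw [iterateFrobenius_add, iterateFrobenius_one]
    exact ih.comp hfrob

theorem Ideal.map_iterateFrobenius (I : Ideal S) (e : ℕ) :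
    I.map (iterateFrobenius S p e) = I.frobPow (p ^ e) :=
  rfl

theorem IsFFinite.frobSplits [IsNoetherianRing S] [IsLocalRing S] (hff : IsFFinite S p) (c : S)
    (e : ℕ) (h : ∀ N : ℕ, ∃ (I : Ideal S) (w : S), I ≤ maximalIdeal S ^ N ∧
      maximalIdeal S ≤ I.radical ∧ GeneratesSocle I w ∧ w ^ p ^ e * c ∉ I.frobPow (p ^ e)) :
    FrobSplits p c e :=
  RingHom.exists_addMonoidHom_eq_one (hff.finite_iterateFrobenius e) c h

end

section

variable {R S : Type*} [CommRing R] [CommRing S] [Algebra R S] {p : ℕ} [Fact p.Prime]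

theorem Ideal.frobPow_map_sup_span [CharP R p] [CharP S p] (J : Ideal R) {ι : Type*} (z : ι → S)
    (e : ℕ) :
    (J.map (algebraMap R S) ⊔ Ideal.span (Set.range z)).frobPow (p ^ e) =
      (J.frobPow (p ^ e)).map (algebraMap R S) ⊔
        Ideal.span (Set.range fun i ↦ z i ^ p ^ e) := by
  rw [← Ideal.map_iterateFrobenius, ← Ideal.map_iterateFrobenius, Ideal.map_sup, Ideal.map_span,
    ← Set.range_comp, Ideal.map_map, Ideal.map_map]
  congr 2
  ext x
  exact (map_pow (algebraMap R S) x _).symm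

theorem Ideal.le_radical_frobPow {I J : Ideal R} (h : I ≤ J.radical) {q : ℕ} :
    I ≤ (J.frobPow q).radical := by
  intro a ha
  obtain ⟨k, hk⟩ := h ha
  exact ⟨k * q, pow_mul a k q ▸ Ideal.subset_span ⟨_, hk, rfl⟩⟩

theorem mul_pow_mem_of_pow_mul_mem_frobPow [IsNoetherianRing R] [IsLocalRing R] [Module.Flat R S]
    [CharP R p] [CharP S p] {ι : Type*} [Fintype ι] {z : ι → S}
    (hz : PermRegularMod ((maximalIdeal R).map (algebraMap R S)) z) {J : Ideal R}
    (hJ : maximalIdeal R ≤ J.radical) {e N : ℕ} {u : R} (hu : u ^ p ^ e ∉ J.frobPow (p ^ e))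
    {b c : S} (h : ((b * ∏ i, z i ^ N) * algebraMap R S u) ^ p ^ e * c ∈
      (J.map (algebraMap R S) ⊔ Ideal.span (Set.range fun i ↦ z i ^ (N + 1))).frobPow (p ^ e)) :
    c * b ^ p ^ e ∈ (maximalIdeal R).map (algebraMap R S) ⊔
      Ideal.span (Set.range fun i ↦ z i ^ p ^ e) := by
  refine (hz.pow (p ^ e)).mem_of_mul_prod_mem N ?_
  rw [Ideal.frobPow_map_sup_span] at h
  have h1 := FlatMod.of_permRegularMod ((hz.pow (N + 1)).pow (p ^ e)) (J.frobPow (p ^ e))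
    (Ideal.le_radical_frobPow hJ) (u ^ p ^ e) (c * (b * ∏ i, z i ^ N) ^ p ^ e) (by
      rw [map_pow, mul_assoc, ← mul_pow, mul_comm c]
      exact h)
  have h2 : Submodule.colon (J.frobPow (p ^ e)) {u ^ p ^ e} ≤ maximalIdeal R := by
    refine le_maximalIdeal fun htop ↦ hu ?_
    have : (1 : R) ∈ Submodule.colon (J.frobPow (p ^ e)) {u ^ p ^ e} := htop ▸ Submodule.mem_top
    simpa using Submodule.mem_colon_singleton.mp this
  have h3 := sup_le_sup_right (Ideal.map_mono (f := algebraMap R S) h2) _ h1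
  simp only [← pow_mul] at h3 ⊢
  simp only [mul_comm (p ^ e)]
  rw [mul_pow, ← Finset.prod_pow, ← mul_assoc] at h3
  simpa only [← pow_mul] using h3

end

/-- **Proposition 3.3(2)** (Aberbach). Let `(R,m,K) → (S,n,L)` be a flat local
homomorphism of F-finite reduced Noetherian local rings of prime characteristic `p`
with Gorenstein closed fiber. Write `E_R(K) = lim_t R/J_t` along a nested sequence of
irreducible `m`-primary ideals `J_t` (cofinal with the powers of `m`), with injective
transition maps `f_t` and socle representatives `u_t ↦ u_{t+1}`. If `0` is Frobenius
closed in `E_R(K)`, `S/mS` is F-rational and `c ∈ S − mS`, then `S c^{1/q} ⊆ S^{1/q}`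
splits over `S` for some `q`. -/
theorem frobSplits_of_frobeniusClosed_zero_in_injective_hull
    (p : ℕ) [Fact p.Prime]
    (R S : Type*) [CommRing R] [CommRing S]
    [IsNoetherianRing R] [IsNoetherianRing S]
    [IsLocalRing R] [IsLocalRing S] [CharP R p] [CharP S p]
    [IsReduced R] [IsReduced S] (hffR : IsFFinite R p) (hffS : IsFFinite S p)
    [Algebra R S] [Module.Flat R S] [IsLocalHom (algebraMap R S)]
    [IsLocalRing (S ⧸ Ideal.map (algebraMap R S) (IsLocalRing.maximalIdeal R))]
    (hGor : IsGorensteinLocalRing (S ⧸ Ideal.map (algebraMap R S) (IsLocalRing.maximalIdeal R)))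
    -- the direct limit presentation `E_R(K) = lim_t R/J_t`
    (J : ℕ → Ideal R) (hnested : ∀ t, J (t + 1) ≤ J t)
    (hirr : ∀ t, (J t).IsIrreducible)
    (hprimary : ∀ t, IsLocalRing.maximalIdeal R ≤ (J t).radical)
    (hcofinal : ∀ N : ℕ, ∃ t, J t ≤ IsLocalRing.maximalIdeal R ^ N)
    (f : ∀ t : ℕ, (R ⧸ J t) →ₗ[R] (R ⧸ J (t + 1)))
    (hfinj : ∀ t, Function.Injective (f t))
    (u : ℕ → R)
    (husoc : ∀ t, GeneratesSocle (J t) (u t))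
    (hu : ∀ t, f t (Ideal.Quotient.mk (J t) (u t)) = Ideal.Quotient.mk (J (t + 1)) (u (t + 1)))
    -- `0` is Frobenius closed in `E_R(K)`
    (hFrobE : ∀ u' : ℕ → R,
      (∀ t, f t (Ideal.Quotient.mk (J t) (u' t)) = Ideal.Quotient.mk (J (t + 1)) (u' (t + 1))) →
      (∃ e t : ℕ, u' t ^ p ^ e ∈ (J t).frobPow (p ^ e)) → ∃ t, u' t ∈ J t)
    (hFrat : IsFRational (S ⧸ Ideal.map (algebraMap R S) (IsLocalRing.maximalIdeal R)) p)
    (c : S) (hc : c ∉ Ideal.map (algebraMap R S) (IsLocalRing.maximalIdeal R)) :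
    ∃ e : ℕ, FrobSplits p c e := by
  classical
  obtain ⟨n, x, hx, hreg, hirrx⟩ := hGor
  have hp : 1 < p := (Fact.out : p.Prime).one_lt
  obtain ⟨b', hb'⟩ := hirrx.exists_generatesSocle hx.2.2
  obtain ⟨b, rfl⟩ := Ideal.Quotient.mk_surjective b'
  choose z hz using fun i ↦ Ideal.Quotient.mk_surjective (x i)
  obtain rfl : (fun i ↦ Ideal.Quotient.mk ((maximalIdeal R).map (algebraMap R S)) (z i)) = x :=
    funext hz
  have hmap : ∀ w : Fin n → S,
      (Ideal.span (Set.range w)).map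
          (Ideal.Quotient.mk ((maximalIdeal R).map (algebraMap R S))) =
        Ideal.span (Set.range fun i ↦
          Ideal.Quotient.mk ((maximalIdeal R).map (algebraMap R S)) (w i)) := fun w ↦ by
    rw [Ideal.map_span, ← Set.range_comp]
    rfl
  have hperm : PermRegularMod ((maximalIdeal R).map (algebraMap R S)) z :=
    .of_quotient (.of_isWeaklyRegular hreg.toIsWeaklyRegular hx.2.1)
  have hzm : ∀ i, z i ∈ maximalIdeal S := fun i ↦
    Ideal.Quotient.mk_mem_maximalIdeal_iff.mp (hx.2.1 i)
  have hb : GeneratesSocle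
      ((maximalIdeal R).map (algebraMap R S) ⊔ Ideal.span (Set.range z)) b := by
    rwa [← generatesSocle_map_mk_iff, hmap]
  obtain ⟨e, he⟩ := hFrat.exists_mul_pow_notMem hp hx
    (c := Ideal.Quotient.mk ((maximalIdeal R).map (algebraMap R S)) c)
    (fun h ↦ hc (Ideal.Quotient.eq_zero_iff_mem.mp h)) hb'.2.1
  refine ⟨e, hffS.frobSplits c e fun N ↦ ?_⟩
  obtain ⟨t, ht⟩ := hcofinal N
  have hle : (maximalIdeal R).map (algebraMap R S) ≤ maximalIdeal S :=
    map_maximalIdeal_le _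
  refine ⟨(J t).map (algebraMap R S) ⊔ Ideal.span (Set.range fun i ↦ z i ^ (N + 1)),
    (b * ∏ i, z i ^ N) * algebraMap R S (u t), sup_le ?_ ?_, ?_, ?_, fun hmem ↦ he ?_⟩
  · refine (Ideal.map_mono ht).trans ?_
    rw [Ideal.map_pow]
    exact Ideal.pow_right_mono hle N
  · rw [Ideal.span_le]
    rintro _ ⟨i, rfl⟩
    exact Ideal.pow_le_pow_right N.le_succ (Ideal.pow_mem_pow (hzm i) (N + 1))
  · intro a ha
    obtain ⟨k, hk⟩ := hx.2.2 (Ideal.Quotient.mk_mem_maximalIdeal_iff.mpr ha)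
    rw [← map_pow, ← hmap, Ideal.mem_quotient_iff_mem_sup] at hk
    refine Ideal.mem_radical_of_pow_mem (m := k) ((show _ ≤ Ideal.radical _ from sup_le ?_ ?_) hk)
    · rw [Ideal.span_le]
      rintro _ ⟨i, rfl⟩
      exact ⟨N + 1, Ideal.mem_sup_right (Ideal.subset_span ⟨i, rfl⟩)⟩
    · refine (Ideal.map_mono (hprimary t)).trans ((Ideal.map_radical_le _).trans ?_)
      exact Ideal.radical_mono le_sup_left
  · exact (FlatMod.of_permRegularMod (hperm.pow (N + 1))).generatesSocle (hprimary t) (husoc t)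
      (hperm.generatesSocle_pow hzm hb N)
  · have hut : u t ^ p ^ e ∉ (J t).frobPow (p ^ e) := fun h ↦ by
      obtain ⟨s, hs⟩ := hFrobE u hu ⟨e, t, h⟩
      exact (husoc s).2.1 hs
    have h1 := mul_pow_mem_of_pow_mul_mem_frobPow hperm (hprimary t) hut hmem
    rw [sup_comm, ← Ideal.mem_quotient_iff_mem_sup, hmap, map_mul, map_pow] at h1
    refine Ideal.span_mono ?_ h1
    rintro _ ⟨i, rfl⟩
    exact ⟨_, Ideal.subset_span ⟨i, rfl⟩, (map_pow _ _ _).symm⟩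
end

section
/- Let φ:(R,m)→(S,n) be a flat local homomorphism of Noetherian local rings. Let z_1,…,z_d ∈ S be elements whose images in S/mS form a regular sequence. Then for any ideal I of S generated by monomials in z_1,…,z_d, the ring S/I is flat over R. -/
open TensorProduct

section LocalCriterion

variable {B : Type*} (S : Type*) [CommRing B] [CommRing S] [Algebra B S]

/-- The multiplication map `S ⊗ J → S` for an ideal `J` of `B` and a `B`-algebra `S`. -/
noncomputable def Ideal.tensorMul (J : Ideal B) : S ⊗[B] J →ₗ[S] S :=
  (AlgebraTensorModule.rid B S S).toLinearMap ∘ₗ J.subtype.baseChange S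

@[simp]
lemma Ideal.tensorMul_tmul (J : Ideal B) (s : S) (j : J) :
    J.tensorMul S (s ⊗ₜ j) = (j : B) • s := rfl

lemma Module.Flat.of_tensorMul_injective
    (h : ∀ J : Ideal B, Function.Injective (J.tensorMul S)) : Module.Flat B S := by
  refine Module.Flat.iff_lTensor_injective'.2 fun J => ?_
  exact Function.Injective.of_comp (f := AlgebraTensorModule.rid B S S) (h J)

lemma Ideal.tensorMul_lTensor_inclusion {J J' : Ideal B} (h : J ≤ J') (t : S ⊗[B] J) :
    J'.tensorMul S ((Submodule.inclusion h).lTensor S t) = J.tensorMul S t := by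
  induction t with
  | zero => simp
  | add a b ha hb => simp only [map_add, ha, hb]
  | tmul s j => simp

lemma Ideal.mem_smul_top_iff_exists_tensorMul (J : Ideal B) (s : S) :
    s ∈ (J • ⊤ : Submodule B S) ↔ ∃ t, J.tensorMul S t = s := by
  constructor
  · intro hs
    induction hs using Submodule.smul_induction_on' with
    | smul j hj s _ => exact ⟨s ⊗ₜ ⟨j, hj⟩, by simp⟩
    | add a _ b _ ha hb =>
      obtain ⟨t, rfl⟩ := ha
      obtain ⟨u, rfl⟩ := hb
      exact ⟨t + u, map_add _ _ _⟩
  · rintro ⟨t, rfl⟩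
    induction t with
    | zero => simp
    | add a b ha hb => simpa using add_mem ha hb
    | tmul s j => exact Submodule.smul_mem_smul j.2 trivial

lemma Ideal.algebraMap_smul_eq_tensorMul_tmul (J : Ideal B) (b : J) (t : S ⊗[B] J) :
    algebraMap B S b • t = J.tensorMul S t ⊗ₜ b := by
  induction t with
  | zero => simp
  | add a c ha hc => simp only [smul_add, ha, hc, map_add, add_tmul]
  | tmul s j =>
    rw [algebraMap_smul, smul_tmul', tensorMul_tmul, smul_tmul, smul_tmul]
    congr 1
    ext
    simp [mul_comm]

lemma Ideal.tensorMul_sup_span_singleton_injective {J : Ideal B} {x : B}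
    (hJ : Function.Injective (J.tensorMul S))
    (hx : ∀ s : S, x • s ∈ (J • ⊤ : Submodule B S) → s ∈ (J • ⊤ : Submodule B S)) :
    Function.Injective ((J ⊔ span {x}).tensorMul S) := by
  have hle : J ≤ J ⊔ span {x} := le_sup_left
  let x' : ↥(J ⊔ span {x}) := ⟨x, mem_sup_right (mem_span_singleton_self x)⟩
  have decomp (t : S ⊗[B] ↥(J ⊔ span {x})) :
      ∃ s u, t = s ⊗ₜ x' + (Submodule.inclusion hle).lTensor S u := by
    induction t with
    | zero => exact ⟨0, 0, by simp⟩
    | add a b ha hb =>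
      obtain ⟨s, u, rfl⟩ := ha
      obtain ⟨s', u', rfl⟩ := hb
      exact ⟨s + s', u + u', by rw [add_tmul, map_add]; abel⟩
    | tmul s j =>
      obtain ⟨j, hj⟩ := j
      obtain ⟨i, hi, y, hy, rfl⟩ := Submodule.mem_sup.1 hj
      obtain ⟨b, rfl⟩ := mem_span_singleton'.1 hy
      refine ⟨b • s, s ⊗ₜ ⟨i, hi⟩, ?_⟩
      rw [smul_tmul, LinearMap.lTensor_tmul, ← tmul_add]
      congr 1
      ext
      simp [x', add_comm]
  refine (injective_iff_map_eq_zero _).2 fun t ht => ?_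
  obtain ⟨s, u, rfl⟩ := decomp t
  rw [map_add, tensorMul_tmul, tensorMul_lTensor_inclusion] at ht
  obtain ⟨v, rfl⟩ := (J.mem_smul_top_iff_exists_tensorMul S s).1 <| hx s <|
    (J.mem_smul_top_iff_exists_tensorMul S _).2 ⟨-u, by
      rw [map_neg]; exact (eq_neg_of_add_eq_zero_left ht).symm⟩
  have hv : J.tensorMul S v ⊗ₜ x' = (Submodule.inclusion hle).lTensor S (x • v) := by
    rw [← tensorMul_lTensor_inclusion S hle, ← algebraMap_smul_eq_tensorMul_tmul, map_smul,
      algebraMap_smul]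
  have hvu : x • v + u = 0 := by
    refine (injective_iff_map_eq_zero _).1 hJ _ ?_
    rw [map_add, ← ht, ← algebraMap_smul S x v, map_smul, algebraMap_smul]
  rw [hv, ← map_add, hvu, map_zero]

open scoped Pointwise in
lemma Ideal.tensorMul_sup_ofList_injective (xs : List B) {J : Ideal B}
    (hJ : Function.Injective (J.tensorMul S))
    (hxs : RingTheory.Sequence.IsWeaklyRegular (S ⧸ (J • ⊤ : Submodule B S)) xs) :
    Function.Injective ((J ⊔ ofList xs).tensorMul S) := by
  induction xs generalizing J with
  | nil => rwa [ofList_nil, sup_bot_eq]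
  | cons x xs ih =>
    rw [RingTheory.Sequence.isWeaklyRegular_cons_iff] at hxs
    rw [ofList_cons, ← sup_assoc]
    refine ih (tensorMul_sup_span_singleton_injective S hJ fun s hs => ?_) ?_
    · rw [← Submodule.Quotient.mk_eq_zero] at hs ⊢
      exact hxs.1.right_eq_zero_of_smul hs
    · refine (LinearEquiv.isWeaklyRegular_congr ?_ xs).1 hxs.2
      refine (Submodule.quotEquivOfEq _ _ ?_) ≪≫ₗ
        Submodule.quotientQuotientEquivQuotientSup (J • ⊤) (x • (⊤ : Submodule B S)) ≪≫ₗ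
        Submodule.quotEquivOfEq _ _ ?_
      · rw [Submodule.map_pointwise_smul, Submodule.map_top, Submodule.range_mkQ]
      · rw [Submodule.sup_smul, Submodule.ideal_span_singleton_smul]

/-- If `S` is flat over `R` and `R → B → S`, then `(IB) ⊗ S → S` is injective for ideals `I`
of `R`. -/
lemma Ideal.tensorMul_map_injective {R : Type*} [CommRing R] [Algebra R B] [Algebra R S]
    [IsScalarTower R B S] [Module.Flat R S] (I : Ideal R) :
    Function.Injective ((I.map (algebraMap R B)).tensorMul S) := by
  let g : S ⊗[R] I →ₗ[R] S ⊗[B] (I.map (algebraMap R B)) :=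
    TensorProduct.lift <| LinearMap.mk₂ R
      (fun s i => s ⊗ₜ[B] ⟨algebraMap R B i, mem_map_of_mem _ i.2⟩)
      (fun _ _ _ => add_tmul _ _ _) (fun _ _ _ => rfl)
      (fun s i j => by rw [← tmul_add]; congr 1; ext; simp)
      (fun c s i => by
        rw [smul_tmul', ← algebraMap_smul B c s, smul_tmul]
        congr 1
        ext
        simp [Algebra.smul_def])
  have hg : Function.Surjective g := by
    intro t
    induction t with
    | zero => exact ⟨0, map_zero _⟩
    | add a b ha hb =>
      obtain ⟨u, rfl⟩ := ha
      obtain ⟨v, rfl⟩ := hb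
      exact ⟨u + v, map_add _ _ _⟩
    | tmul s j =>
      obtain ⟨j, hj⟩ := j
      induction hj using Submodule.span_induction generalizing s with
      | mem j hj =>
        obtain ⟨i, hi, rfl⟩ := hj
        exact ⟨s ⊗ₜ ⟨i, hi⟩, rfl⟩
      | zero => exact ⟨0, by rw [map_zero]; exact (tmul_zero _ _).symm⟩
      | add a b ha hb iha ihb =>
        obtain ⟨u, hu⟩ := iha s
        obtain ⟨v, hv⟩ := ihb s
        exact ⟨u + v, by rw [map_add, hu, hv, ← tmul_add]; rfl⟩
      | smul b a ha iha =>
        obtain ⟨u, hu⟩ := iha (b • s)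
        exact ⟨u, by rw [hu, smul_tmul]; rfl⟩
  have hgμ (v : S ⊗[R] I) : (I.map (algebraMap R B)).tensorMul S (g v) = I.tensorMul S v := by
    induction v with
    | zero => simp
    | add a b ha hb => simp only [map_add, ha, hb]
    | tmul s i => exact algebraMap_smul B (i : R) s
  refine (injective_iff_map_eq_zero _).2 fun t ht => ?_
  obtain ⟨v, rfl⟩ := hg t
  have hv : v = 0 := by
    refine (injective_iff_map_eq_zero (I.tensorMul S)).1 ?_ _ ((hgμ v).symm.trans ht)
    exact (AlgebraTensorModule.rid R S S).injective.comp
      (Module.Flat.iff_lTensor_injective'.1 inferInstance I)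
  rw [hv, map_zero]

/-- If `(J : a) = Q`, the kernel of `J ⊗ S → S` is obtained by multiplying the kernel of
`Q ⊗ S → S` by `a`, as soon as `(J + aB) ⊗ S → S` is injective. -/
lemma Ideal.exists_tensorMul_eq_zero_of_sup_span_singleton {J Q : Ideal B} {a : B}
    (hQ : ∀ c, c ∈ Q ↔ c * a ∈ J)
    (hsup : Function.Injective ((J ⊔ span {a}).tensorMul S))
    {t : S ⊗[B] J} (ht : J.tensorMul S t = 0) :
    ∃ u : S ⊗[B] Q, Q.tensorMul S u = 0 ∧
      ((LinearMap.mulRight B a).restrict fun c hc => (hQ c).1 hc).lTensor S u = t := by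
  have hle : J ≤ J ⊔ span {a} := le_sup_left
  let a' : ↥(J ⊔ span {a}) := ⟨a, mem_sup_right (mem_span_singleton_self a)⟩
  let ρ : Q →ₗ[B] J := (LinearMap.mulRight B a).restrict fun c hc => (hQ c).1 hc
  let f : Q →ₗ[B] J × B := ρ.prod (-Q.subtype)
  let g : J × B →ₗ[B] ↥(J ⊔ span {a}) :=
    (Submodule.inclusion hle).coprod (LinearMap.toSpanSingleton B _ a')
  have hfg : Function.Exact f g := by
    rintro ⟨j, b⟩
    constructor
    · intro h
      have h' : (j : B) + b * a = 0 := congrArg Subtype.val h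
      refine ⟨⟨-b, (hQ _).2 ?_⟩, ?_⟩
      · rw [neg_mul, ← eq_neg_of_add_eq_zero_left h']
        exact j.2
      · refine Prod.ext (Subtype.ext ?_) (neg_neg b)
        exact (neg_mul b a).trans (eq_neg_of_add_eq_zero_left h').symm
    · rintro ⟨c, hc⟩
      rw [← hc]
      refine Subtype.ext ?_
      change (c : B) * a + (-(c : B)) * a = 0
      ring
  have hg : Function.Surjective g := by
    rintro ⟨y, hy⟩
    obtain ⟨j, hj, w, hw, rfl⟩ := Submodule.mem_sup.1 hy
    obtain ⟨b, rfl⟩ := mem_span_singleton'.1 hw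
    exact ⟨(⟨j, hj⟩, b), rfl⟩
  have ht0 : g.lTensor S ((LinearMap.inl B J B).lTensor S t) = 0 := by
    rw [← LinearMap.lTensor_comp_apply, LinearMap.coprod_inl]
    refine (injective_iff_map_eq_zero _).1 hsup _ ?_
    rw [tensorMul_lTensor_inclusion, ht]
  obtain ⟨u, hu⟩ := (lTensor_exact S hfg hg _).1 ht0
  refine ⟨u, ?_, ?_⟩
  · have h := congrArg ((LinearMap.snd B J B).lTensor S) hu
    rw [← LinearMap.lTensor_comp_apply, ← LinearMap.lTensor_comp_apply, LinearMap.snd_prod,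
      LinearMap.snd_comp_inl, LinearMap.lTensor_zero, LinearMap.lTensor_neg, LinearMap.zero_apply,
      LinearMap.neg_apply, neg_eq_zero] at h
    exact (congrArg (AlgebraTensorModule.rid B S S) h).trans (map_zero _)
  · have h := congrArg ((LinearMap.fst B J B).lTensor S) hu
    rwa [← LinearMap.lTensor_comp_apply, ← LinearMap.lTensor_comp_apply, LinearMap.fst_prod,
      LinearMap.fst_comp_inl, LinearMap.lTensor_id, LinearMap.id_apply] at h

/-- A form of the local criterion of flatness. -/
theorem Module.Flat.of_tensorMul_comap_maximalIdeal_injective [IsNoetherianRing B]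
    [IsNoetherianRing S] [IsLocalRing S]
    (h : Function.Injective
      (((IsLocalRing.maximalIdeal S).comap (algebraMap B S)).tensorMul S)) :
    Module.Flat B S := by
  refine Module.Flat.of_tensorMul_injective S fun J => ?_
  set p := (IsLocalRing.maximalIdeal S).comap (algebraMap B S)
  induction J using IsNoetherian.induction with
  | hgt J ih =>
  by_cases hJp : J ≤ p
  · obtain rfl | hlt := hJp.eq_or_lt
    · exact h
    obtain ⟨a, hap, haJ⟩ := SetLike.exists_of_lt hlt
    have hsup := ih (J ⊔ Ideal.span {a}) (left_lt_sup.2 fun hle =>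
      haJ (hle (Ideal.mem_span_singleton_self a)))
    obtain ⟨Q, hQ⟩ : ∃ Q : Ideal B, ∀ c, c ∈ Q ↔ c * a ∈ J :=
      ⟨Submodule.comap (LinearMap.mulRight B a) J, fun _ => Iff.rfl⟩
    have hJQ : J ≤ Q := fun c hc => (hQ c).2 (Ideal.mul_mem_right a J hc)
    obtain rfl | hlt := hJQ.eq_or_lt
    · rw [← LinearMap.ker_eq_bot]
      refine Submodule.eq_bot_of_le_smul_of_le_jacobson_bot (IsLocalRing.maximalIdeal S) _
        (IsNoetherian.noetherian _) (fun t ht => ?_) (IsLocalRing.maximalIdeal_le_jacobson _)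
      obtain ⟨u, hu, rfl⟩ :=
        Ideal.exists_tensorMul_eq_zero_of_sup_span_singleton S hQ hsup (LinearMap.mem_ker.1 ht)
      have hau : ((LinearMap.mulRight B a).restrict fun c hc => (hQ c).1 hc).lTensor S u =
          algebraMap B S a • u := by
        have : ((LinearMap.mulRight B a).restrict fun c hc => (hQ c).1 hc) =
            a • (LinearMap.id : J →ₗ[B] J) := by
          ext c
          exact mul_comm (c : B) a
        rw [this, LinearMap.lTensor_smul, LinearMap.lTensor_id, algebraMap_smul]
        rfl
      rw [hau]
      exact Submodule.smul_mem_smul hap (LinearMap.mem_ker.2 hu)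
    · refine (injective_iff_map_eq_zero _).2 fun t ht => ?_
      obtain ⟨u, hu, rfl⟩ := Ideal.exists_tensorMul_eq_zero_of_sup_span_singleton S hQ hsup ht
      rw [(injective_iff_map_eq_zero _).1 (ih Q hlt) u hu, map_zero]
  · obtain ⟨b, hbJ, hbp⟩ := SetLike.not_le_iff_exists.1 hJp
    have hb : IsUnit (algebraMap B S b) := by
      simpa [p] using hbp
    refine (injective_iff_map_eq_zero _).2 fun t ht => ?_
    rw [← hb.smul_eq_zero, Ideal.algebraMap_smul_eq_tensorMul_tmul S J ⟨b, hbJ⟩, ht, zero_tmul]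

end LocalCriterion



/-- The quotient of a polynomial ring by a monomial ideal is flat over the coefficient ring. -/
lemma MvPolynomial.flat_quotient_span_monomial {σ R : Type*} [CommRing R] (A : Set (σ →₀ ℕ)) :
    Module.Flat R (MvPolynomial σ R ⧸ Ideal.span ((fun a => monomial a (1 : R)) '' A)) := by
  classical
  set I := Ideal.span ((fun a => monomial a (1 : R)) '' A) with hI
  let U : Set (σ →₀ ℕ) := {m | ∃ a ∈ A, a ≤ m}
  let π : MvPolynomial σ R →ₗ[R] MvPolynomial σ R :=
    (basisMonomials σ R).constr R fun m => if m ∈ U then 0 else monomial m 1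
  have hπ (m : σ →₀ ℕ) : π (monomial m 1) = if m ∈ U then 0 else monomial m 1 := by
    simpa using (basisMonomials σ R).constr_basis R (fun m => if m ∈ U then 0 else monomial m 1) m
  have hker : I.restrictScalars R ≤ LinearMap.ker π := by
    intro x hx
    rw [Submodule.restrictScalars_mem, hI, mem_ideal_span_monomial_image] at hx
    rw [LinearMap.mem_ker, x.as_sum, map_sum]
    refine Finset.sum_eq_zero fun m hm => ?_
    rw [← mul_one (x.coeff m), ← smul_eq_mul, ← smul_monomial, map_smul, hπ, if_pos (show m ∈ U from hx m hm),
      smul_zero]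
  have : Module.Flat R (MvPolynomial σ R ⧸ I.restrictScalars R) := by
    refine Module.Flat.of_retract (M := MvPolynomial σ R) ((I.restrictScalars R).liftQ π hker)
      (I.restrictScalars R).mkQ ?_
    refine Submodule.linearMap_qext _ ((basisMonomials σ R).ext fun m => ?_)
    rw [coe_basisMonomials, LinearMap.id_comp, LinearMap.comp_assoc, Submodule.liftQ_mkQ,
      LinearMap.comp_apply, hπ, ← sub_eq_zero, ← map_sub, Submodule.mkQ_apply,
      Submodule.Quotient.mk_eq_zero, Submodule.restrictScalars_mem]
    split_ifs with hm
    · rw [zero_sub, neg_mem_iff, hI, mem_ideal_span_monomial_image]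
      intro n hn
      rw [Finset.mem_singleton.1 (support_monomial_subset hn)]
      exact hm
    · rw [sub_self]
      exact zero_mem _
  exact Module.Flat.of_linearEquiv (Submodule.Quotient.restrictScalarsEquiv R I).symm

lemma Module.Flat.quotient_map {R B S : Type*} [CommRing R] [CommRing B] [CommRing S]
    [Algebra R B] [Algebra B S] [Algebra R S] [IsScalarTower R B S] [Module.Flat B S]
    (I : Ideal B) [Module.Flat R (B ⧸ I)] : Module.Flat R (S ⧸ I.map (algebraMap B S)) := by
  have : Module.Flat R ((B ⧸ I) ⊗[B] S) := Module.Flat.trans R (B ⧸ I) _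
  let e : (B ⧸ I) ⊗[B] S ≃ₗ[B] (S ⧸ I.map (algebraMap B S)) :=
    TensorProduct.comm B _ _ ≪≫ₗ (I.qoutMapEquivTensorQout S).symm.restrictScalars B
  exact Module.Flat.of_linearEquiv (e.restrictScalars R).symm

/-- A sequence regular modulo `mS` gives a flat map from the polynomial ring. -/
theorem flat_mvPolynomial_of_isWeaklyRegular {R S : Type*} [CommRing R] [CommRing S]
    [IsNoetherianRing R] [IsNoetherianRing S] [IsLocalRing R] [IsLocalRing S]
    [Algebra R S] [Module.Flat R S] [IsLocalHom (algebraMap R S)] {d : ℕ} (z : Fin d → S)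
    (hz : ∀ i, z i ∈ IsLocalRing.maximalIdeal S)
    [Algebra (MvPolynomial (Fin d) R) S] [IsScalarTower R (MvPolynomial (Fin d) R) S]
    (hX : ∀ i, algebraMap (MvPolynomial (Fin d) R) S (MvPolynomial.X i) = z i)
    (hreg : RingTheory.Sequence.IsWeaklyRegular
      (S ⧸ (IsLocalRing.maximalIdeal R).map (algebraMap R S))
      (List.ofFn fun i =>
        Ideal.Quotient.mk ((IsLocalRing.maximalIdeal R).map (algebraMap R S)) (z i))) :
    Module.Flat (MvPolynomial (Fin d) R) S := by
  set B := MvPolynomial (Fin d) R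
  set m := IsLocalRing.maximalIdeal R
  set J := m.map (algebraMap R B)
  let xs : List B := List.ofFn fun i => MvPolynomial.X i
  have hmap : J.map (algebraMap B S) = m.map (algebraMap R S) := by
    rw [Ideal.map_map, ← IsScalarTower.algebraMap_eq]
  have hxs : RingTheory.Sequence.IsWeaklyRegular (S ⧸ (J • ⊤ : Submodule B S)) xs := by
    have h : (List.ofFn fun i => Ideal.Quotient.mk (m.map (algebraMap R S)) (z i)) =
        xs.map (algebraMap B (S ⧸ m.map (algebraMap R S))) := by
      rw [List.map_ofFn]
      congr 1
      ext i
      rw [← hX]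
      rfl
    rw [h, RingTheory.Sequence.isWeaklyRegular_map_algebraMap_iff] at hreg
    refine (LinearEquiv.isWeaklyRegular_congr ?_ xs).1 hreg
    refine (Submodule.Quotient.restrictScalarsEquiv B _).symm ≪≫ₗ Submodule.quotEquivOfEq _ _ ?_
    rw [Ideal.smul_top_eq_map, hmap]
  have hX_mem (i) : MvPolynomial.X i ∈ (IsLocalRing.maximalIdeal S).comap (algebraMap B S) := by
    rw [Ideal.mem_comap, hX]
    exact hz i
  have hp : (IsLocalRing.maximalIdeal S).comap (algebraMap B S) = J ⊔ Ideal.ofList xs := by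
    refine le_antisymm (fun f hf => ?_) (sup_le ?_ ?_)
    · have hsub (f : B) : f - MvPolynomial.C (MvPolynomial.constantCoeff f) ∈
          Ideal.ofList xs := by
        induction f using MvPolynomial.induction_on with
        | C a => simp
        | add f g hf hg =>
          convert add_mem hf hg using 1
          simp only [map_add]
          ring
        | mul_X f i =>
          simpa using Ideal.mul_mem_left _ f
            (Ideal.subset_span (List.mem_ofFn.2 ⟨i, rfl⟩) : MvPolynomial.X i ∈ Ideal.ofList xs)
      have hle : Ideal.ofList xs ≤ (IsLocalRing.maximalIdeal S).comap (algebraMap B S) := by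
        refine Ideal.span_le.2 fun x hx => ?_
        obtain ⟨i, rfl⟩ := List.mem_ofFn.1 hx
        exact hX_mem i
      have hC : MvPolynomial.constantCoeff f ∈ m := by
        have h := sub_mem hf (hle (hsub f))
        rw [sub_sub_cancel, Ideal.mem_comap, ← MvPolynomial.algebraMap_eq,
          ← IsScalarTower.algebraMap_apply] at h
        exact (IsLocalRing.mem_maximalIdeal _).2 fun hu =>
          (IsLocalRing.mem_maximalIdeal _).1 h (hu.map _)
      rw [← sub_add_cancel f (MvPolynomial.C (MvPolynomial.constantCoeff f)), add_comm]
      exact Submodule.add_mem_sup (Ideal.mem_map_of_mem _ hC) (hsub f)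
    · rw [← Ideal.map_le_iff_le_comap, hmap]
      exact Ideal.map_le_iff_le_comap.2 fun r hr =>
        map_mem_nonunits_iff (algebraMap R S) r |>.2 hr
    · refine Ideal.span_le.2 fun x hx => ?_
      obtain ⟨i, rfl⟩ := List.mem_ofFn.1 hx
      exact hX_mem i
  refine Module.Flat.of_tensorMul_comap_maximalIdeal_injective S ?_
  rw [hp]
  exact Ideal.tensorMul_sup_ofList_injective S xs (Ideal.tensorMul_map_injective S m) hxs

lemma RingTheory.Sequence.IsRegular.mem_maximalIdeal_of_quotient {S : Type*} [CommRing S]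
    [IsLocalRing S] {K : Ideal S} {d : ℕ} {z : Fin d → S}
    (h : RingTheory.Sequence.IsRegular (S ⧸ K) (List.ofFn fun i => Ideal.Quotient.mk K (z i)))
    (i : Fin d) : z i ∈ IsLocalRing.maximalIdeal S := by
  by_contra hi
  refine h.top_ne_smul ?_
  have hu : IsUnit (Ideal.Quotient.mk K (z i)) :=
    (IsLocalRing.notMem_maximalIdeal.1 hi).map _
  have hmem : Ideal.Quotient.mk K (z i) ∈
      Ideal.ofList (List.ofFn fun i => Ideal.Quotient.mk K (z i)) :=
    Ideal.subset_span (List.mem_ofFn.2 ⟨i, rfl⟩)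
  rw [Ideal.eq_top_of_isUnit_mem _ hmem hu, Submodule.top_smul]

/-- **Lemma 3.1** (Aberbach). Let `φ : (R,m) → (S,n)` be a flat local homomorphism of
Noetherian local rings and let `z₁,…,z_d ∈ S` be elements whose images in `S/mS` form a
regular sequence. Then for any ideal `I` of `S` generated by monomials in the `z`'s, the
ring `S/I` is flat over `R`. -/
theorem flat_quotient_by_monomial_ideal
    (R S : Type*) [CommRing R] [CommRing S]
    [IsNoetherianRing R] [IsNoetherianRing S]
    [IsLocalRing R] [IsLocalRing S]
    [Algebra R S] [Module.Flat R S] [IsLocalHom (algebraMap R S)]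
    (d : ℕ) (z : Fin d → S)
    (hreg : RingTheory.Sequence.IsRegular
      (S ⧸ Ideal.map (algebraMap R S) (IsLocalRing.maximalIdeal R))
      (List.ofFn fun i =>
        Ideal.Quotient.mk (Ideal.map (algebraMap R S) (IsLocalRing.maximalIdeal R)) (z i)))
    (I : Ideal S) (A : Set (Fin d → ℕ))
    (hI : I = Ideal.span ((fun a : Fin d → ℕ => ∏ i, z i ^ a i) '' A)) :
    Module.Flat R (S ⧸ I) := by
  let _ : Algebra (MvPolynomial (Fin d) R) S := (MvPolynomial.aeval z).toAlgebra
  have hX (i) : algebraMap (MvPolynomial (Fin d) R) S (MvPolynomial.X i) = z i :=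
    MvPolynomial.aeval_X z i
  have : IsScalarTower R (MvPolynomial (Fin d) R) S :=
    .of_algebraMap_eq fun r => ((MvPolynomial.aeval z).commutes r).symm
  have := flat_mvPolynomial_of_isWeaklyRegular z hreg.mem_maximalIdeal_of_quotient hX
    hreg.toIsWeaklyRegular
  let e : (Fin d → ℕ) → (Fin d →₀ ℕ) := Finsupp.equivFunOnFinite.symm
  have := MvPolynomial.flat_quotient_span_monomial (R := R) (e '' A)
  have hI' : I = (Ideal.span ((fun a => MvPolynomial.monomial a (1 : R)) '' (e '' A))).map
      (algebraMap (MvPolynomial (Fin d) R) S) := by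
    rw [hI, Ideal.map_span, Set.image_image, Set.image_image]
    congr 1
    refine Set.image_congr fun a _ => ?_
    change _ = MvPolynomial.aeval z (MvPolynomial.monomial (e a) (1 : R))
    rw [MvPolynomial.aeval_monomial, map_one, one_mul, Finsupp.prod_fintype _ _ (by simp)]
    rfl
  rw [hI']
  exact Module.Flat.quotient_map _
end

section
/- Let (R,m)→(B,n_B) be a flat local homomorphism of F-finite reduced Noetherian local rings of prime characteristic p such that mB = n_B (i.e., the closed fiber B/mB is a field). If R is strongly F-regular, then B is strongly F-regular. -/
open IsLocalRing

section

open scoped TensorProduct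

/-- Over a finitely generated ideal `I`, linear maps into the flat base change of an injective
module extend from the extended ideal `I S` to `S`. -/
lemma exists_smul_eq_of_baer {R S E : Type*} [CommRing R] [IsNoetherianRing R] [CommRing S]
    [Algebra R S] [Module.Flat R S] [AddCommGroup E] [Module R E] (hE : Module.Baer R E)
    (I : Ideal R) (h : (I.map (algebraMap R S)) →ₗ[S] (S ⊗[R] E)) :
    ∃ x : S ⊗[R] E, ∀ a, h a = (a : S) • x := by
  obtain ⟨k, μ, hμ⟩ := Submodule.fg_iff_exists_fin_generating_family.mp
    (IsNoetherian.noetherian I)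
  have hμI : ∀ i, μ i ∈ I := fun i => hμ ▸ Submodule.subset_span ⟨i, rfl⟩
  let π : (Fin k → R) →ₗ[R] R := Fintype.linearCombination R μ
  obtain ⟨l, σ, hσ⟩ := Submodule.fg_iff_exists_fin_generating_family.mp
    (IsNoetherian.noetherian (LinearMap.ker π))
  have hσ0 : ∀ j, ∑ i, σ j i * μ i = 0 := fun j => by
    have : σ j ∈ LinearMap.ker π := hσ ▸ Submodule.subset_span ⟨j, rfl⟩
    simpa [π, Fintype.linearCombination_apply] using this
  let f : E →ₗ[R] (Fin k → E) := LinearMap.pi fun i => LinearMap.lsmul R E (μ i)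
  let g : (Fin k → E) →ₗ[R] (Fin l → E) :=
    LinearMap.pi fun j => ∑ i, (σ j i) • LinearMap.proj i
  have hfg : Function.Exact f g := by
    intro e
    constructor
    · intro he
      have he' : ∀ j, ∑ i, σ j i • e i = 0 := fun j => by
        simpa [g] using congrFun he j
      let τ : (Fin k → R) →ₗ[R] E := Fintype.linearCombination R e
      have hker : LinearMap.ker π ≤ LinearMap.ker τ := by
        rw [← hσ, Submodule.span_le]
        rintro _ ⟨j, rfl⟩
        simpa [τ, Fintype.linearCombination_apply] using he' j
      let φ : LinearMap.range π →ₗ[R] E :=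
        (LinearMap.ker π).liftQ τ hker ∘ₗ π.quotKerEquivRange.symm.toLinearMap
      obtain ⟨φ', hφ'⟩ := hE (LinearMap.range π) φ
      refine ⟨φ' 1, funext fun i => ?_⟩
      have hμi : π (Pi.single i 1) = μ i := by
        simp [π, Fintype.linearCombination_apply, Pi.single_apply]
      have h1 : φ' (μ i) = e i := by
        rw [hφ' (μ i) ⟨_, hμi⟩]
        have h2 : π.quotKerEquivRange.symm ⟨μ i, ⟨_, hμi⟩⟩
            = (LinearMap.ker π).mkQ (Pi.single i 1) := by
          rw [LinearEquiv.symm_apply_eq]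
          ext
          simp [hμi]
        simp only [φ, LinearMap.comp_apply, LinearEquiv.coe_coe, h2]
        simp [τ, Fintype.linearCombination_apply, Pi.single_apply]
      simp only [f, LinearMap.pi_apply, LinearMap.lsmul_apply]
      rw [← h1, ← map_smul, smul_eq_mul, mul_one]
    · rintro ⟨x, rfl⟩
      funext j
      simp only [g, f, LinearMap.pi_apply, LinearMap.sum_apply, LinearMap.smul_apply,
        LinearMap.proj_apply, LinearMap.lsmul_apply, smul_smul, Pi.zero_apply]
      rw [← Finset.sum_smul, hσ0, zero_smul]
  have hex := Module.Flat.lTensor_exact S hfg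
  have hmem : ∀ i, algebraMap R S (μ i) ∈ I.map (algebraMap R S) :=
    fun i => Ideal.mem_map_of_mem _ (hμI i)
  let ξ := (TensorProduct.piRight R S S (fun _ : Fin k => E)).symm
    (fun i => h ⟨algebraMap R S (μ i), hmem i⟩)
  have hg : ∀ z : S ⊗[R] (Fin k → E), ∀ j,
      TensorProduct.piRight R S S (fun _ : Fin l => E) (g.lTensor S z) j
      = ∑ i, algebraMap R S (σ j i) •
        TensorProduct.piRight R S S (fun _ : Fin k => E) z i := by
    intro z j
    induction z using TensorProduct.induction_on with
    | zero => simp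
    | tmul s e => simp [g, TensorProduct.tmul_sum]
    | add x y hx hy => simp only [map_add, Pi.add_apply, hx, hy, smul_add, Finset.sum_add_distrib]
  have hf : ∀ z : S ⊗[R] E, ∀ i,
      TensorProduct.piRight R S S (fun _ : Fin k => E) (f.lTensor S z) i
      = algebraMap R S (μ i) • z := by
    intro z i
    induction z using TensorProduct.induction_on with
    | zero => simp
    | tmul s e => simp [f]
    | add x y hx hy => simp only [map_add, Pi.add_apply, hx, hy, smul_add]
  have hξ : g.lTensor S ξ = 0 := by
    apply (TensorProduct.piRight R S S (fun _ : Fin l => E)).injective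
    funext j
    rw [hg]
    simp only [ξ, LinearEquiv.apply_symm_apply, map_zero, Pi.zero_apply]
    simp_rw [← map_smul]
    rw [← map_sum]
    convert map_zero h
    ext
    simp only [AddSubmonoidClass.coe_finsetSum, SetLike.val_smul, smul_eq_mul, ← map_mul,
      ← map_sum, hσ0]
    simp
  obtain ⟨x, hx⟩ := (hex ξ).mp hξ
  refine ⟨x, ?_⟩
  have hxi : ∀ i, h ⟨algebraMap R S (μ i), hmem i⟩ = algebraMap R S (μ i) • x := fun i => by
    rw [← hf x i, hx]
    simp [ξ]
  have hspan : I.map (algebraMap R S) =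
      Submodule.span S (Set.range fun i => algebraMap R S (μ i)) := by
    rw [← hμ, Ideal.submodule_span_eq, Ideal.map_span, ← Set.range_comp]
    rfl
  have hmem_iff : ∀ a, a ∈ Submodule.span S (Set.range fun i => algebraMap R S (μ i)) →
      a ∈ I.map (algebraMap R S) := fun a ha => hspan ▸ ha
  rintro ⟨a, ha⟩
  have ha' := ha
  rw [hspan] at ha'
  induction ha' using Submodule.span_induction with
  | mem y hy =>
    obtain ⟨i, rfl⟩ := hy
    exact hxi i
  | zero => exact (map_zero h).trans (zero_smul S x).symm
  | add y z hy hz ihy ihz =>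
    have := map_add h ⟨y, hmem_iff y hy⟩ ⟨z, hmem_iff z hz⟩
    rw [ihy (hmem_iff y hy), ihz (hmem_iff z hz), ← add_smul] at this
    exact this
  | smul b y hy ihy =>
    have := map_smul h b ⟨y, hmem_iff y hy⟩
    rw [ihy (hmem_iff y hy), smul_smul] at this
    exact this

/-- If every linear map `I → X` extends to the ring, then linear maps to `X` extend from submodules
of noetherian modules killed by a power of `I`. -/
lemma exists_extension_of_pow_smul_eq_zero {S X N : Type*} [CommRing S] [AddCommGroup X]
    [Module S X] [AddCommGroup N] [Module S N] [IsNoetherian S N] {I : Ideal S} (hI : I.IsMaximal)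
    (hX : ∀ h : I →ₗ[S] X, ∃ x : X, ∀ a, h a = (a : S) • x) {t : ℕ}
    (ht : ∀ a ∈ I ^ t, ∀ y : N, a • y = 0) (f : N →ₗ.[S] X) :
    ∃ g : N →ₗ[S] X, ∀ x : f.domain, g x = f x := by
  obtain ⟨D, hD⟩ : ∃ D, D = f.domain := ⟨_, rfl⟩
  induction D using WellFoundedGT.induction generalizing f with
  | ind D ih =>
  subst hD
  by_cases htop : f.domain = ⊤
  · exact ⟨f.toFun ∘ₗ (LinearEquiv.ofTop _ htop).symm.toLinearMap, fun x => rfl⟩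
  obtain ⟨x, hx, hxI⟩ : ∃ x ∉ f.domain, ∀ a ∈ I, a • x ∈ f.domain := by
    by_contra! hcon
    have key : ∀ s, ∃ x ∉ f.domain, ∃ b ∈ I ^ s, ∃ y : N, x = b • y := by
      intro s
      induction s with
      | zero =>
        obtain ⟨x, hx⟩ : ∃ x, x ∉ f.domain := by
          by_contra! h
          exact htop (eq_top_iff.mpr fun x _ => h x)
        exact ⟨x, hx, 1, by simp, x, by simp⟩
      | succ s ihs =>
        obtain ⟨x, hx, b, hb, y, rfl⟩ := ihs
        obtain ⟨a, ha, hax⟩ := hcon _ hx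
        exact ⟨_, hax, a * b, by rw [pow_succ']; exact Ideal.mul_mem_mul ha hb, y, smul_smul ..⟩
    obtain ⟨x, hx, b, hb, y, rfl⟩ := key t
    exact hx (ht b hb y ▸ zero_mem _)
  let ψ : I →ₗ[S] f.domain :=
    ((LinearMap.toSpanSingleton S N x).domRestrict I).codRestrict f.domain
      (fun a => by simpa using hxI a a.2)
  obtain ⟨y, hy⟩ := hX (f.toFun ∘ₗ ψ)
  have hmem : ∀ c : S, c • x ∈ f.domain → c ∈ I := by
    intro c hc
    by_contra hcI
    obtain ⟨d, i, hi, hdi⟩ := hI.exists_inv hcI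
    apply hx
    have : x = d • c • x + i • x := by rw [smul_smul, ← add_smul, hdi, one_smul]
    rw [this]
    exact add_mem (Submodule.smul_mem _ _ hc) (hxI i hi)
  have hy' : ∀ (c : S) (w : f.domain), (w : N) = c • x → f w = c • y := by
    intro c w hw
    have hc : c ∈ I := hmem c (hw ▸ w.2)
    rw [← hy ⟨c, hc⟩]
    have : w = ψ ⟨c, hc⟩ := by ext; simpa [ψ] using hw
    rw [this]
    rfl
  have H : ∀ c : S, c • x = 0 → (RingHom.id S) c • y = 0 := by
    intro c hc
    have := hy' c 0 (by simp [hc])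
    simpa using this.symm
  let f2 : N →ₗ.[S] X := LinearPMap.mkSpanSingleton' x y H
  have hcompat : ∀ (a : f.domain) (b : f2.domain), (a : N) = b → f a = f2 b := by
    rintro a ⟨b, hb⟩ hab
    obtain ⟨c, rfl⟩ := Submodule.mem_span_singleton.mp hb
    rw [hy' c a hab]
    exact (LinearPMap.mkSpanSingleton'_apply x y H c hb).symm
  have hlt : f.domain < (f.sup f2 hcompat).domain := by
    rw [LinearPMap.domain_sup]
    refine lt_of_le_of_ne le_sup_left fun h => hx ?_
    rw [h]
    exact Submodule.mem_sup_right (Submodule.mem_span_singleton_self x)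
  obtain ⟨g, hg⟩ := ih _ hlt (f.sup f2 hcompat) rfl
  refine ⟨g, fun w => ?_⟩
  have hle := f.left_le_sup f2 hcompat
  rw [hle.2 (x := w) (y := ⟨w, hle.1 w.2⟩) rfl]
  exact hg ⟨w, hle.1 w.2⟩

/-- A map `S → M`, `1 ↦ c` that does not split fails to be injective after tensoring with some
module of finite length. -/
lemma exists_tmul_eq_zero_of_not_split {S : Type*} {M : Type*} [CommRing S] [IsNoetherianRing S]
    [IsLocalRing S] [AddCommGroup M] [Module S M] [Module.Finite S M] (c : M)
    (h : ¬ ∃ θ : M →ₗ[S] S, θ c = 1) :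
    ∃ (a : ℕ) (K : Submodule S ((Fin a → S) × S)) (t : ℕ) (z : ((Fin a → S) × S) ⧸ K),
      (∀ b ∈ maximalIdeal S ^ t, ∀ y : ((Fin a → S) × S) ⧸ K, b • y = 0) ∧ z ≠ 0 ∧
      c ⊗ₜ[S] z = 0 := by
  obtain ⟨b, μ, hμ⟩ := Submodule.fg_iff_exists_fin_generating_family.mp
    (Module.Finite.fg_top (R := S) (M := M))
  let π : (Fin b → S) →ₗ[S] M := Fintype.linearCombination S μ
  have hπ : Function.Surjective π := by
    rw [← LinearMap.range_eq_top, Fintype.range_linearCombination, hμ]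
  obtain ⟨a, σ, hσ⟩ := Submodule.fg_iff_exists_fin_generating_family.mp
    (IsNoetherian.noetherian (LinearMap.ker π))
  have hσ0 : ∀ j, ∑ i, σ j i • μ i = 0 := fun j => by
    have : σ j ∈ LinearMap.ker π := hσ ▸ Submodule.subset_span ⟨j, rfl⟩
    simpa [π, Fintype.linearCombination_apply] using this
  obtain ⟨v, rfl⟩ := hπ c
  let G : (Fin b → S) →ₗ[S] (Fin a → S) × S :=
    (LinearMap.pi fun j => Fintype.linearCombination S (σ j)).prod
      (Fintype.linearCombination S v)
  have hG : ((0, 1) : (Fin a → S) × S) ∉ LinearMap.range G := by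
    rintro ⟨w, hw⟩
    apply h
    let τ : (Fin b → S) →ₗ[S] S := Fintype.linearCombination S w
    have hker : LinearMap.ker π ≤ LinearMap.ker τ := by
      rw [← hσ, Submodule.span_le]
      rintro _ ⟨j, rfl⟩
      have := congrFun (congrArg Prod.fst hw) j
      simpa [τ, G, Fintype.linearCombination_apply, mul_comm] using this
    refine ⟨(LinearMap.ker π).liftQ τ hker ∘ₗ
      (π.quotKerEquivOfSurjective hπ).symm.toLinearMap, ?_⟩
    have h2 : (π.quotKerEquivOfSurjective hπ).symm (π v) = (LinearMap.ker π).mkQ v := by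
      rw [LinearEquiv.symm_apply_eq]
      simp
    simp only [LinearMap.comp_apply, LinearEquiv.coe_coe, h2]
    have := congrArg Prod.snd hw
    simpa [τ, G, Fintype.linearCombination_apply, mul_comm] using this
  have hy0 : (LinearMap.range G).mkQ (0, 1) ≠ 0 := by simpa using hG
  obtain ⟨t, ht⟩ : ∃ t, (LinearMap.range G).mkQ (0, 1) ∉
      (maximalIdeal S ^ t • ⊤ : Submodule S (((Fin a → S) × S) ⧸ LinearMap.range G)) := by
    by_contra! hcon
    apply hy0
    have := (Submodule.mem_iInf _).mpr hcon
    rwa [Ideal.iInf_pow_smul_eq_bot_of_isLocalRing _ (Ideal.IsPrime.ne_top'),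
      Submodule.mem_bot] at this
  let K : Submodule S ((Fin a → S) × S) :=
    (maximalIdeal S ^ t • ⊤ : Submodule S _).comap (LinearMap.range G).mkQ
  have hGK : ∀ w, K.mkQ (G w) = 0 := by
    intro w
    have h0 : (LinearMap.range G).mkQ (G w) = 0 := by simp
    rw [← LinearMap.mem_ker, Submodule.ker_mkQ, Submodule.mem_comap, h0]
    exact zero_mem _
  have htK : ∀ b ∈ maximalIdeal S ^ t, ∀ y : ((Fin a → S) × S) ⧸ K, b • y = 0 := by
    intro b hb y
    obtain ⟨y, rfl⟩ := K.mkQ_surjective y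
    rw [← map_smul, ← LinearMap.mem_ker, Submodule.ker_mkQ, Submodule.mem_comap, map_smul]
    exact Submodule.smul_mem_smul hb trivial
  let y : ((Fin a → S) × S) ⧸ K := K.mkQ (0, 1)
  have hy : y ≠ 0 := by
    intro h0
    rw [← LinearMap.mem_ker, Submodule.ker_mkQ] at h0
    exact ht h0
  have hcy : π v ⊗ₜ[S] y = 0 := by
    let yj : Fin a → ((Fin a → S) × S) ⧸ K := fun j => K.mkQ (Pi.single j 1, 0)
    have hrel : ∀ i, v i • y = - ∑ j, σ j i • yj j := by
      intro i
      rw [eq_neg_iff_add_eq_zero, ← hGK (Pi.single i 1)]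
      simp only [y, yj, ← map_smul, ← map_sum, ← map_add]
      congr 1
      ext j
      · simp [G, Fintype.linearCombination_apply, Prod.fst_sum, Finset.sum_apply, Pi.single_apply]
      · simp [G, Fintype.linearCombination_apply, Prod.snd_sum, Pi.single_apply]
    simp only [π, Fintype.linearCombination_apply, TensorProduct.sum_tmul,
      TensorProduct.smul_tmul, hrel, TensorProduct.tmul_neg, TensorProduct.tmul_sum,
      Finset.sum_neg_distrib, neg_eq_zero]
    rw [Finset.sum_comm]
    simp only [← TensorProduct.smul_tmul, ← TensorProduct.sum_tmul, hσ0, TensorProduct.zero_tmul,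
      Finset.sum_const_zero]
  exact ⟨a, K, t, y, htK, hy, hcy⟩

lemma exists_baer_socle (R : Type*) [CommRing R] [IsLocalRing R] :
    ∃ u : CharacterModule R, u ≠ 0 ∧ ∀ a ∈ maximalIdeal R, a • u = 0 := by
  obtain ⟨χ, hχ⟩ := CharacterModule.exists_character_apply_ne_zero_of_ne_zero
    (one_ne_zero (α := ResidueField R))
  let u : CharacterModule R := χ.comp (residue R).toAddMonoidHom
  refine ⟨u, fun h => hχ ?_, fun a ha => ?_⟩
  · have h1 : χ (residue R 1) = 0 := DFunLike.congr_fun h (1 : R)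
    rwa [map_one] at h1
  · ext r
    have h0 : residue R (a * r) = 0 :=
      (residue_eq_zero_iff _).mpr (Ideal.mul_mem_right _ _ ha)
    rw [CharacterModule.smul_apply]
    change χ (residue R (a • r)) = 0
    rw [smul_eq_mul, h0, map_zero]

lemma mem_map_ker_of_tmul_eq_zero {A C W : Type*} [CommRing A] [CommRing C] [Algebra A C]
    [Module.Flat A C] [AddCommGroup W] [Module A W] (w : W) (c : C) (h : c ⊗ₜ[A] w = 0) :
    c ∈ Ideal.map (algebraMap A C) (LinearMap.ker (LinearMap.toSpanSingleton A W w)) := by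
  set f := LinearMap.toSpanSingleton A W w
  have hex := Module.Flat.lTensor_exact C (LinearMap.exact_subtype_ker_map f)
  obtain ⟨ξ, hξ⟩ := (hex (c ⊗ₜ 1)).mp (by simpa [f] using h)
  have key : ∀ ξ : C ⊗[A] (LinearMap.ker f),
      TensorProduct.rid A C ((LinearMap.ker f).subtype.lTensor C ξ) ∈
        Ideal.map (algebraMap A C) (LinearMap.ker f) := by
    intro ξ
    induction ξ using TensorProduct.induction_on with
    | zero => simp
    | tmul x y =>
      simp only [LinearMap.lTensor_tmul, TensorProduct.rid_tmul, Algebra.smul_def]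
      exact Ideal.mul_mem_right _ _ (Ideal.mem_map_of_mem _ y.2)
    | add x y hx hy => simpa only [map_add] using add_mem hx hy
  have := key ξ
  rw [hξ] at this
  simpa using this

/-- Splitting descends along the base change of a finite algebra: if `1 ↦ c` does not split, then
`c` lies in the extension of the ideal of elements of `R'` that do not split. -/
theorem exists_split_of_flat {R S R' S' : Type*} [CommRing R] [CommRing S] [CommRing R']
    [CommRing S'] [IsNoetherianRing R] [IsNoetherianRing S] [IsLocalRing R] [IsLocalRing S]
    [Algebra R S] [Algebra R R'] [Algebra R S'] [Algebra S S'] [Algebra R' S']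
    [IsScalarTower R S S'] [IsScalarTower R R' S'] [Module.Flat R S] [Module.Flat R' S']
    [Module.Finite S S']
    (hm : (maximalIdeal R).map (algebraMap R S) = maximalIdeal S) (c : S')
    (J : Ideal R') (hJ : ∀ r, (¬ ∃ θ : R' →ₗ[R] R, θ r = 1) → r ∈ J)
    (hc : c ∉ J.map (algebraMap R' S')) : ∃ θ : S' →ₗ[S] S, θ c = 1 := by
  by_contra hsplit
  obtain ⟨a, K, t, z, htK, hz, hcz⟩ := exists_tmul_eq_zero_of_not_split c hsplit
  obtain ⟨u, hu, hum⟩ := exists_baer_socle R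
  have hE : Module.Baer R (CharacterModule R) :=
    Module.Flat.iff_characterModule_baer.mp inferInstance
  have hX := exists_smul_eq_of_baer (S := S) hE (maximalIdeal R)
  rw [hm] at hX
  have hum' : ∀ b ∈ maximalIdeal S, b • (1 ⊗ₜ u : S ⊗[R] CharacterModule R) = 0 := by
    intro b hb
    rw [← hm] at hb
    refine Submodule.span_induction (p := fun b _ => b • (1 ⊗ₜ u : S ⊗[R] CharacterModule R) = 0)
      ?_ (by simp) (fun x y _ _ hx hy => by rw [add_smul, hx, hy, add_zero])
      (fun x y _ hy => by rw [smul_assoc, hy, smul_zero]) hb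
    rintro _ ⟨r, hr, rfl⟩
    rw [algebraMap_smul, ← TensorProduct.tmul_smul, hum r hr, TensorProduct.tmul_zero]
  have H : ∀ b : S, b • z = 0 → (RingHom.id S) b • (1 ⊗ₜ u : S ⊗[R] CharacterModule R) = 0 := by
    intro b hb
    refine hum' b ((mem_maximalIdeal b).mpr fun hu => hz ?_)
    exact (hu.smul_eq_zero).mp hb
  obtain ⟨ψ, hψ⟩ := exists_extension_of_pow_smul_eq_zero (maximalIdeal.isMaximal S) hX htK
    (LinearPMap.mkSpanSingleton' z (1 ⊗ₜ u : S ⊗[R] CharacterModule R) H)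
  have hψz : ψ z = 1 ⊗ₜ u := by
    have hmem := Submodule.mem_span_singleton_self (R := S) z
    rw [hψ ⟨z, hmem⟩]
    exact LinearPMap.mkSpanSingleton'_apply_self z _ H hmem
  have h1 : c ⊗ₜ[S] (1 ⊗ₜ[R] u : S ⊗[R] CharacterModule R) = 0 := by
    rw [← hψz, ← LinearMap.lTensor_tmul, hcz, map_zero]
  have h2 : c ⊗ₜ[R] u = 0 := by
    have := congrArg (TensorProduct.AlgebraTensorModule.cancelBaseChange R S S S' _) h1
    simpa using this
  have h3 : c ⊗ₜ[R'] (1 ⊗ₜ[R] u : R' ⊗[R] CharacterModule R) = 0 := by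
    have := congrArg (TensorProduct.AlgebraTensorModule.cancelBaseChange R R' R' S' _).symm h2
    simpa using this
  refine hc (Ideal.map_mono ?_ (mem_map_ker_of_tmul_eq_zero _ _ h3))
  intro r hr
  refine hJ r ?_
  rintro ⟨θ, hθ⟩
  apply hu
  have hr' : r ⊗ₜ[R] u = 0 := by
    simpa [TensorProduct.smul_tmul'] using hr
  have := congrArg (TensorProduct.lid R _ ∘ θ.rTensor (CharacterModule R)) hr'
  simpa [hθ] using this

end

/-- The ring homomorphism form of `exists_split_of_flat`. -/
lemma exists_addMonoidHom_of_flat {R S R' S' : Type*} [CommRing R] [CommRing S] [CommRing R']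
    [CommRing S'] [IsNoetherianRing R] [IsNoetherianRing S] [IsLocalRing R] [IsLocalRing S]
    (f : R →+* S) (f' : R' →+* S') (φ : R →+* R') (ψ : S →+* S') (hcomm : f'.comp φ = ψ.comp f)
    (hf : f.Flat) (hf' : f'.Flat) (hψ : ψ.Finite)
    (hm : (maximalIdeal R).map f = maximalIdeal S) (c : S') (J : Ideal R')
    (hJ : ∀ r, (¬ ∃ θ : R' →+ R, (∀ a x, θ (φ a * x) = a * θ x) ∧ θ r = 1) → r ∈ J)
    (hc : c ∉ J.map f') :
    ∃ θ : S' →+ S, (∀ a x, θ (ψ a * x) = a * θ x) ∧ θ c = 1 := by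
  algebraize [f, f', φ, ψ, ψ.comp f]
  have : IsScalarTower R R' S' := IsScalarTower.of_algebraMap_eq' hcomm.symm
  obtain ⟨θ, hθ⟩ := exists_split_of_flat (R := R) (S := S) (R' := R') (S' := S') hm c J
    (fun r hr => hJ r fun ⟨θ, hθ, h1⟩ => hr
      ⟨{ θ with map_smul' := fun a x => (congrArg θ (Algebra.smul_def a x)).trans (hθ a x) }, h1⟩)
    hc
  exact ⟨θ.toAddMonoidHom, fun a x =>
    (congrArg θ (Algebra.smul_def a x).symm).trans (θ.map_smul a x), hθ⟩

/-- A compatible system of ideals `Q t ⊇ m ^ t` (in other words, an ideal of the completion) is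
generated by a number of elements that does not depend on `t`. -/
lemma exists_uniform_generators {R : Type*} [CommRing R] [IsNoetherianRing R] (m : Ideal R)
    (Q : ℕ → Ideal R) (hmQ : ∀ t, m ^ t ≤ Q t) (hQ : ∀ t t', t ≤ t' → Q t' ⊔ m ^ t = Q t) :
    ∃ n : ℕ, ∀ t, ∃ r : Fin n → R, (∀ i, r i ∈ Q t) ∧
      Q t ≤ Ideal.span (Set.range r) ⊔ m ^ t := by
  have hanti : ∀ t t', t ≤ t' → Q t' ≤ Q t := fun t t' h => (hQ t t' h) ▸ le_sup_left
  let F : m.Filtration R :=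
    { N := fun s => Q (s + 1) ⊓ m ^ s
      mono := fun s => le_inf (inf_le_left.trans (hanti _ _ (by lia)))
        (inf_le_right.trans (Ideal.pow_le_pow_right (by lia)))
      smul_le := fun s => by
        rw [Submodule.smul_le]
        rintro a ha x ⟨hxQ, hxm⟩
        have hax : a * x ∈ m ^ (s + 1) := by
          rw [pow_succ']
          exact Ideal.mul_mem_mul ha hxm
        refine ⟨?_, hax⟩
        have hxQ' : x ∈ Q (s + 1) := hxQ
        rw [← hQ (s + 1) (s + 1 + 1) (by lia)] at hxQ'
        obtain ⟨y, hy, z, hz, rfl⟩ := Submodule.mem_sup.mp hxQ'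
        rw [smul_eq_mul, mul_add]
        refine add_mem (Ideal.mul_mem_left _ _ hy) (hmQ _ ?_)
        rw [pow_succ' m (s + 1)]
        exact Ideal.mul_mem_mul ha hz }
  have hF : F.Stable := by
    refine (m.stableFiltration_stable (⊤ : Submodule R R)).of_le fun s => ?_
    refine inf_le_right.trans (le_of_eq ?_)
    simp
  obtain ⟨s₀, hs₀⟩ := hF.exists_pow_smul_eq_of_ge
  obtain ⟨n, ρ, hρ⟩ := Submodule.fg_iff_exists_fin_generating_family.mp
    (IsNoetherian.noetherian (Q (s₀ + 1)))
  have main : ∀ t, s₀ + 1 ≤ t → ∃ r : Fin n → R, (∀ i, r i ∈ Q t) ∧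
      Q t ≤ Ideal.span (Set.range r) ⊔ m ^ t := by
    intro t ht
    have hlift : ∀ i, ∃ x ∈ Q t, ρ i - x ∈ m ^ (s₀ + 1) := by
      intro i
      have hi : ρ i ∈ Q (s₀ + 1) := hρ ▸ Submodule.subset_span ⟨i, rfl⟩
      rw [← hQ _ t ht] at hi
      obtain ⟨y, hy, z, hz, hyz⟩ := Submodule.mem_sup.mp hi
      exact ⟨y, hy, by rw [← hyz, add_sub_cancel_left]; exact hz⟩
    choose r hrQ hr using hlift
    have hJ : Ideal.span (Set.range r) ≤ Q t := by
      rw [Ideal.span_le]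
      rintro _ ⟨i, rfl⟩
      exact hrQ i
    have hbase : Q (s₀ + 1) ≤ Ideal.span (Set.range r) ⊔ m ^ (s₀ + 1) := by
      rw [← hρ, Submodule.span_le]
      rintro _ ⟨i, rfl⟩
      rw [← sub_add_cancel (ρ i) (r i)]
      exact add_mem (Submodule.mem_sup_right (hr i))
        (Submodule.mem_sup_left (Ideal.subset_span ⟨i, rfl⟩))
    have hstep : ∀ s, s₀ + 1 ≤ s → s ≤ t → Q t ≤ Ideal.span (Set.range r) ⊔ m ^ s := by
      intro s hs
      induction s, hs using Nat.le_induction with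
      | base => exact fun _ => (hanti _ _ ht).trans hbase
      | succ s hs ih =>
        intro hst x hx
        obtain ⟨j, hj, y, hy, rfl⟩ := Submodule.mem_sup.mp (ih (by lia) hx)
        refine add_mem (Submodule.mem_sup_left hj) ?_
        have hyQ : y ∈ Q t := by simpa using sub_mem hx (hJ hj)
        have hyF : y ∈ F.N s := ⟨hanti _ _ hst hyQ, hy⟩
        rw [hs₀ s (by lia)] at hyF
        have hle : m ^ (s - s₀) • F.N s₀ ≤
            m ^ (s - s₀) * (Ideal.span (Set.range r) ⊔ m ^ (s₀ + 1)) :=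
          Ideal.mul_mono_right (inf_le_left.trans hbase)
        have hy' := hle hyF
        rw [Ideal.mul_sup, ← pow_add, show s - s₀ + (s₀ + 1) = s + 1 by lia] at hy'
        have hsup : m ^ (s - s₀) * Ideal.span (Set.range r) ⊔ m ^ (s + 1) ≤
            Ideal.span (Set.range r) ⊔ m ^ (s + 1) := sup_le_sup_right Ideal.mul_le_right _
        exact hsup hy'
    exact ⟨r, hrQ, hstep t ht le_rfl⟩
  refine ⟨n, fun t => ?_⟩
  obtain ht | ht := le_total (s₀ + 1) t
  · exact main t ht
  · obtain ⟨r, hr, hQr⟩ := main _ le_rfl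
    refine ⟨r, fun i => hanti _ _ ht (hr i), ?_⟩
    rw [← hQ t _ ht]
    exact sup_le (hQr.trans (sup_le_sup_left (Ideal.pow_le_pow_right ht) _)) le_sup_right

/-- A relative form of Nakayama's lemma: if `x J ⊆ J ^ 2 + K` with `J` generated by `n` elements,
then some `d ≡ x ^ n` modulo `J` satisfies `d J ⊆ K`. -/
lemma exists_sub_pow_mem_and_mul_mem {R : Type*} [CommRing R] {n : ℕ} (r : Fin n → R) (x : R)
    (K : Ideal R)
    (h : ∀ i, x * r i ∈ Ideal.span (Set.range r) * Ideal.span (Set.range r) ⊔ K) :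
    ∃ d, d - x ^ n ∈ Ideal.span (Set.range r) ∧ ∀ i, d * r i ∈ K := by
  set J := Ideal.span (Set.range r) with hJ
  have hrel : ∀ i, ∃ a : Fin n → R, (∀ j, a j ∈ J) ∧ x * r i - ∑ j, a j * r j ∈ K := by
    intro i
    obtain ⟨y, hy, z, hz, hyz⟩ := Submodule.mem_sup.mp (h i)
    nth_rw 2 [hJ] at hy
    obtain ⟨a, ha, hay⟩ := (Submodule.mem_ideal_smul_span_iff_exists_sum J r y).mp hy
    refine ⟨a, ha, ?_⟩
    rw [← hyz, ← hay, Finsupp.sum_fintype _ _ (by simp)]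
    simpa using hz
  choose A hA hAK using hrel
  let M : Matrix (Fin n) (Fin n) R := Matrix.scalar (Fin n) x - Matrix.of A
  refine ⟨M.det, ?_, fun j => ?_⟩
  · rw [← Ideal.Quotient.eq, RingHom.map_det]
    have : (Ideal.Quotient.mk J).mapMatrix M = Matrix.scalar (Fin n) (Ideal.Quotient.mk J x) := by
      ext i j
      simp only [M, map_sub, RingHom.mapMatrix_apply, Matrix.sub_apply, Matrix.map_apply,
        Matrix.of_apply, Ideal.Quotient.eq_zero_iff_mem.mpr (hA i j), sub_zero]
      by_cases hij : i = j
      · subst hij; simp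
      · simp [hij]
    rw [this]
    simp
  · have hmul : M.adjugate.mulVec (M.mulVec r) = M.det • r := by
      rw [Matrix.mulVec_mulVec, Matrix.adjugate_mul, Matrix.smul_mulVec, Matrix.one_mulVec]
    have := congrFun hmul j
    rw [Pi.smul_apply, smul_eq_mul] at this
    rw [← this, Matrix.mulVec, dotProduct]
    refine Ideal.sum_mem _ fun i _ => Ideal.mul_mem_left _ _ ?_
    have : M.mulVec r i = x * r i - ∑ j, A i j * r j := by
      simp [M, Matrix.mulVec, dotProduct, Matrix.diagonal_apply, sub_mul, Finset.sum_sub_distrib]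
    rw [this]
    exact hAK i

/-- A finite module over a domain is generically free: after multiplication by a nonzero scalar,
it has finite dual coordinates. -/
lemma exists_smul_eq_sum_smul (A M : Type*) [CommRing A] [IsDomain A] [IsNoetherianRing A]
    [AddCommGroup M] [Module A M] [Module.Finite A M] :
    ∃ c : A, c ≠ 0 ∧ ∃ (n : ℕ) (g : Fin n → M) (φ : Fin n → M →ₗ[A] A),
      ∀ x, c • x = ∑ i, φ i x • g i := by
  obtain ⟨s, hs, hli'⟩ := exists_set_linearIndependent_of_isDomain A M
  have hli : LinearIndependent A ((↑) : s → M) := hli'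
  have : Finite s := hli.finite_of_isNoetherian
  have : Fintype s := Fintype.ofFinite s
  set N := Submodule.span A (Set.range ((↑) : s → M)) with hN
  let b : Module.Basis s A N := Module.Basis.span hli
  have htors : Module.IsTorsion A (M ⧸ N) := by
    rw [← Module.rank_eq_zero_iff_isTorsion]
    have h1 := rank_quotient_add_rank_of_isDomain N
    have h2 : Module.rank A N = Module.rank A M := by
      rw [hN, rank_span hli, ← hs]
      simp
    rw [h2] at h1
    have hlt : Module.rank A M < Cardinal.aleph0 := Module.rank_lt_aleph0 A M
    exact Cardinal.eq_of_add_eq_add_right (by rw [h1, zero_add]) hlt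
  obtain ⟨k, μ, hμ⟩ := Module.Finite.exists_fin (R := A) (M := M)
  have hc : ∀ j, ∃ c : A, c ≠ 0 ∧ c • μ j ∈ N := by
    intro j
    obtain ⟨⟨a, ha⟩, h⟩ := @htors (Submodule.Quotient.mk (μ j))
    refine ⟨a, nonZeroDivisors.ne_zero ha, ?_⟩
    rw [← Submodule.Quotient.mk_eq_zero, Submodule.Quotient.mk_smul]
    exact h
  choose c hc0 hcN using hc
  have hall : ∀ x : M, (∏ j, c j) • x ∈ N := by
    intro x
    have hx : x ∈ Submodule.span A (Set.range μ) := hμ ▸ Submodule.mem_top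
    have hle : Submodule.span A (Set.range μ) ≤ N.comap (LinearMap.lsmul A M (∏ j, c j)) := by
      rw [Submodule.span_le]
      rintro _ ⟨j, rfl⟩
      obtain ⟨d, hd⟩ := Finset.dvd_prod_of_mem c (Finset.mem_univ j)
      simp only [SetLike.mem_coe, Submodule.mem_comap, LinearMap.lsmul_apply]
      rw [hd, mul_comm, mul_smul]
      exact N.smul_mem _ (hcN j)
    exact hle hx
  let f : M →ₗ[A] N := (LinearMap.lsmul A M (∏ j, c j)).codRestrict N hall
  let ε := Fintype.equivFin s
  refine ⟨∏ j, c j, Finset.prod_ne_zero_iff.mpr fun j _ => hc0 j, Fintype.card s,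
    fun i => (ε.symm i : M), fun i => b.coord (ε.symm i) ∘ₗ f, fun x => ?_⟩
  have h1 := congrArg (N.subtype) (b.sum_repr (f x))
  rw [map_sum] at h1
  have h2 : N.subtype (f x) = (∏ j, c j) • x := rfl
  rw [← h2, ← h1, ← ε.symm.sum_comp]
  refine Finset.sum_congr rfl fun i _ => ?_
  have h3 : (b (ε.symm i) : M) = ε.symm i := congrArg Subtype.val (Module.Basis.span_apply hli _)
  simp [h3]

/-- `exists_smul_eq_sum_smul` for a finite ring homomorphism out of a domain. -/
lemma RingHom.exists_mul_eq_sum_of_finite {A C : Type*} [CommRing A] [IsDomain A]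
    [IsNoetherianRing A] [CommRing C] (φ : A →+* C) (hφ : φ.Finite) :
    ∃ c : A, c ≠ 0 ∧ ∃ (n : ℕ) (g : Fin n → C) (θ : Fin n → C →+ A),
      (∀ i a x, θ i (φ a * x) = a * θ i x) ∧ ∀ x, φ c * x = ∑ i, φ (θ i x) * g i := by
  algebraize [φ]
  obtain ⟨c, hc, n, g, θ, h⟩ := exists_smul_eq_sum_smul A C
  refine ⟨c, hc, n, g, fun i => (θ i).toAddMonoidHom, fun i a x => ?_, fun x => ?_⟩
  · exact (congrArg (θ i) (Algebra.smul_def a x).symm).trans ((θ i).map_smul a x)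
  · have := h x
    simp only [Algebra.smul_def] at this
    exact this

lemma RingHom.finite_of_forall_eq_sum {A C : Type*} [CommRing A] [CommRing C] (φ : A →+* C)
    (s : Finset C) (h : ∀ x, ∃ a : C → A, x = ∑ i ∈ s, φ (a i) * i) : φ.Finite := by
  algebraize [φ]
  refine ⟨⟨s, eq_top_iff.mpr fun x _ => ?_⟩⟩
  obtain ⟨a, ha⟩ := h x
  rw [ha]
  refine sum_mem fun i hi => ?_
  have := Submodule.smul_mem (Submodule.span A (s : Set C)) (a i) (Submodule.subset_span hi)
  rwa [Algebra.smul_def] at this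

lemma RingHom.Finite.iterateFrobenius_of_forall_eq_sum {A : Type*} [CommRing A] (p : ℕ)
    [ExpChar A p] (s : Finset A) (h : ∀ x : A, ∃ a : A → A, x = ∑ i ∈ s, a i ^ p * i) (e : ℕ) :
    (iterateFrobenius A p e).Finite := by
  induction e with
  | zero =>
    rw [iterateFrobenius_zero]
    exact RingHom.Finite.id A
  | succ e ih =>
    rw [iterateFrobenius_add, iterateFrobenius_one]
    exact ih.comp ((frobenius A p).finite_of_forall_eq_sum s h)

/-- Additive maps `θ` with `θ (a ^ p ^ e * x) = a * θ x`. -/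
def IsFrobLinear {R : Type*} [CommRing R] (p e : ℕ) (θ : R →+ R) : Prop :=
  ∀ a x : R, θ (a ^ p ^ e * x) = a * θ x

namespace IsFrobLinear

variable {R : Type*} [CommRing R] {p e e' : ℕ} {θ η : R →+ R}

lemma comp_mulLeft (hθ : IsFrobLinear p e θ) (s : R) :
    IsFrobLinear p e (θ.comp (AddMonoidHom.mulLeft s)) := fun a x => by
  simp only [AddMonoidHom.comp_apply, AddMonoidHom.coe_mulLeft]
  rw [mul_left_comm, hθ]

lemma comp (hθ : IsFrobLinear p e θ) (hη : IsFrobLinear p e' η) :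
    IsFrobLinear p (e + e') (θ.comp η) := fun a x => by
  rw [AddMonoidHom.comp_apply, AddMonoidHom.comp_apply, pow_add, pow_mul, hη, hθ]

/-- An inverse-Frobenius-linear map sends the Frobenius power of an ideal into the ideal. -/
lemma apply_mem (hθ : IsFrobLinear p e θ) [ExpChar R p] {I : Ideal R} {x : R}
    (hx : x ∈ I.map (iterateFrobenius R p e)) : θ x ∈ I := by
  suffices ∀ s, θ (s * x) ∈ I by simpa using this 1
  refine Submodule.span_induction (p := fun x _ => ∀ s, θ (s * x) ∈ I) ?_ ?_ ?_ ?_ hx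
  · rintro _ ⟨a, ha, rfl⟩ s
    rw [mul_comm, iterateFrobenius_def, hθ]
    exact I.mul_mem_right _ ha
  · simp
  · intro x y _ _ hx hy s
    rw [mul_add, map_add]
    exact add_mem (hx s) (hy s)
  · intro a x _ hx s
    rw [smul_eq_mul, ← mul_assoc]
    exact hx _

/-- Maps inverse-linear for a fixed power of Frobenius are uniformly continuous for the adic
topology, uniformly in the map. -/
lemma exists_apply_mem_pow [IsNoetherianRing R] [IsLocalRing R] [Fact p.Prime] [CharP R p]
    (e N : ℕ) : ∃ T, ∀ θ : R →+ R, IsFrobLinear p e θ → ∀ x ∈ maximalIdeal R ^ T,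
      θ x ∈ maximalIdeal R ^ N := by
  obtain ⟨T, hT⟩ := Ideal.exists_pow_le_of_le_radical_of_fg (I := maximalIdeal R)
    (J := (maximalIdeal R ^ N).map (iterateFrobenius R p e)) (fun x hx => by
      refine ⟨N * p ^ e, ?_⟩
      rw [pow_mul]
      exact Ideal.mem_map_of_mem (iterateFrobenius R p e) (Ideal.pow_mem_pow hx N))
    (IsNoetherian.noetherian _)
  exact ⟨T, fun θ hθ x hx => hθ.apply_mem (hT hx)⟩

end IsFrobLinear

/-- The elements of a local ring which no `p ^ e`-inverse-linear map sends to a unit. -/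
def frobeniusSplittingIdeal (R : Type*) [CommRing R] [IsLocalRing R] (p e : ℕ) : Ideal R where
  carrier := {r | ∀ θ : R →+ R, IsFrobLinear p e θ → θ r ∈ maximalIdeal R}
  zero_mem' θ _ := by simp
  add_mem' hx hy θ hθ := by
    rw [map_add]
    exact add_mem (hx θ hθ) (hy θ hθ)
  smul_mem' s _ hx θ hθ := hx _ (hθ.comp_mulLeft s)

section

variable {R : Type*} [CommRing R] [IsLocalRing R] {p : ℕ}

lemma mem_frobeniusSplittingIdeal_iff {e : ℕ} {r : R} :
    r ∈ frobeniusSplittingIdeal R p e ↔ ¬ FrobSplits p r e := by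
  refine ⟨fun h ⟨θ, hθ, h1⟩ => ?_, fun h θ hθ => ?_⟩
  · have := h θ hθ
    rw [h1] at this
    exact (maximalIdeal.isMaximal R).ne_top ((Ideal.eq_top_iff_one _).mpr this)
  · by_contra hu
    rw [mem_maximalIdeal, mem_nonunits_iff, not_not] at hu
    obtain ⟨u, hu⟩ := hu
    refine h ⟨_, hθ.comp_mulLeft ((↑u⁻¹ : R) ^ p ^ e), ?_⟩
    rw [AddMonoidHom.comp_apply, AddMonoidHom.coe_mulLeft, hθ, ← hu, Units.inv_mul]

lemma frobeniusSplittingIdeal_antitone (h : FrobSplits p (1 : R) 1) :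
    Antitone (frobeniusSplittingIdeal R p) := by
  refine antitone_nat_of_succ_le fun e r hr => ?_
  rw [mem_frobeniusSplittingIdeal_iff] at hr ⊢
  rintro ⟨θ, hθ, h1⟩
  obtain ⟨π, hπ, hπ1⟩ := h
  refine hr ⟨π.comp θ, ?_, ?_⟩
  · have := IsFrobLinear.comp (p := p) hπ hθ
    rwa [add_comm] at this
  · rw [AddMonoidHom.comp_apply, h1, hπ1]

lemma IsFrobLinear.apply_mem_frobeniusSplittingIdeal {θ : R →+ R} (hθ : IsFrobLinear p 1 θ)
    {e : ℕ} {r : R} (hr : r ∈ frobeniusSplittingIdeal R p (e + 1)) :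
    θ r ∈ frobeniusSplittingIdeal R p e :=
  fun _ hη => hr _ (hη.comp hθ)

/-- A strongly `F`-regular reduced Noetherian local ring is a domain. -/
lemma IsStronglyFRegular.isDomain [IsReduced R] [IsNoetherianRing R] (hp : p ≠ 0)
    (h : IsStronglyFRegular R p) : IsDomain R := by
  have hzero : ∀ c ∈ circComplement R, ∀ a, a * c = 0 → a = 0 := by
    intro c hc a hac
    have : a ∈ sInf (minimalPrimes R) := by
      rw [Ideal.mem_sInf]
      intro P hP
      exact (hP.1.1.mem_or_mem (hac ▸ P.zero_mem : a * c ∈ P)).resolve_right (hc P hP)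
    have hbot : sInf (minimalPrimes R) = ⊥ := by
      rw [← Ideal.zero_eq_bot, ← nilradical_eq_zero R, nilradical, ← Ideal.sInf_minimalPrimes]
      rfl
    rw [hbot] at this
    exact this
  have : NoZeroDivisors R := by
    refine ⟨fun {a b} hab => ?_⟩
    set ann : Ideal R := (Ideal.span {a}).annihilator with hann
    have hmem : ∀ {y}, y ∈ ann ↔ y * a = 0 := by
      intro y
      rw [hann, Submodule.mem_annihilator_span_singleton, smul_eq_mul]
    obtain ⟨c, hc, hcc⟩ : ∃ c ∈ Ideal.span {a} ⊔ ann, c ∈ circComplement R := by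
      by_contra! hcon
      have hsub : ((Ideal.span {a} ⊔ ann : Ideal R) : Set R) ⊆
          ⋃ P ∈ minimalPrimes R, ((id P : Ideal R) : Set R) := by
        intro x hx
        have := hcon x hx
        simp only [circComplement, Set.mem_ofPred_eq, not_forall, not_not] at this
        obtain ⟨P, hP, hxP⟩ := this
        exact Set.mem_biUnion hP hxP
      obtain ⟨P, hP, hle⟩ := (Ideal.subset_union_prime_finite
        (minimalPrimes.finite_of_isNoetherianRing R) ⊥ ⊥ (fun P hP _ _ => hP.1.1)).mp hsub
      have hPprime : P.IsPrime := hP.1.1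
      obtain ⟨y, hyP, n, hy⟩ : ∃ y ∉ P, ∃ n, a ^ n * y = 0 := by
        by_contra! hne
        obtain ⟨Q, hQ, -, hdisj⟩ := Ideal.exists_le_prime_disjoint (⊥ : Ideal R)
          (Submonoid.powers a ⊔ P.primeCompl) (by
            rw [Set.disjoint_left]
            rintro _ rfl h0
            obtain ⟨_, ⟨n, rfl⟩, y, hy, hny⟩ := Submonoid.mem_sup.mp h0
            exact hne y hy n hny)
        rw [Set.disjoint_left] at hdisj
        have hQP : Q ≤ P := fun x hx => by
          by_contra hxP
          exact hdisj hx ((le_sup_right : P.primeCompl ≤ Submonoid.powers a ⊔ P.primeCompl) hxP)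
        exact hdisj (hP.2 ⟨hQ, bot_le⟩ hQP
          (hle (Ideal.mem_sup_left (Ideal.mem_span_singleton_self a))))
          ((le_sup_left : Submonoid.powers a ≤ Submonoid.powers a ⊔ P.primeCompl)
            (Submonoid.mem_powers a))
      refine hyP (hle (Ideal.mem_sup_right (hmem.mpr ?_)))
      refine eq_zero_of_pow_eq_zero (n := n + 1) ?_
      rw [show (y * a) ^ (n + 1) = a ^ n * y * (y ^ n * a) by ring, hy, zero_mul]
    obtain ⟨a', ha', y, hy, rfl⟩ := Submodule.mem_sup.mp hc
    obtain ⟨s, rfl⟩ := Ideal.mem_span_singleton'.mp ha'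
    rw [hmem] at hy
    obtain ⟨e, θ, hθ, h1⟩ := h _ hcc
    have hq : p ^ e ≠ 0 := pow_ne_zero _ hp
    rw [map_add] at h1
    obtain hu | hu := IsLocalRing.isUnit_or_isUnit_of_add_one h1
    · have hy0 : y = 0 := by
        have := hθ y (s * a)
        rw [← Nat.succ_pred_eq_of_ne_zero hq, pow_succ, mul_assoc, mul_left_comm y s a, hy,
          mul_zero, mul_zero, map_zero] at this
        exact hu.mul_left_eq_zero.mp this.symm
      right
      refine hzero _ hcc _ ?_
      rw [hy0, add_zero, mul_left_comm, mul_comm b a, hab, mul_zero]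
    · have ha0 : s * a = 0 := by
        have := hθ (s * a) y
        rw [← Nat.succ_pred_eq_of_ne_zero hq, pow_succ, mul_assoc, mul_assoc s a y, mul_comm a y,
          hy, mul_zero, mul_zero, map_zero] at this
        exact hu.mul_left_eq_zero.mp this.symm
      left
      refine hzero _ hcc _ ?_
      rw [ha0, zero_add, mul_comm, hy]
  exact NoZeroDivisors.to_isDomain R

/-- A strongly `F`-regular local domain that is not a field is `F`-split. -/
lemma IsStronglyFRegular.frobSplits_one [IsDomain R] [ExpChar R p] (hm : maximalIdeal R ≠ ⊥)
    (h : IsStronglyFRegular R p) : FrobSplits p (1 : R) 1 := by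
  obtain ⟨c, hcm, hc0⟩ := Submodule.exists_mem_ne_zero_of_ne_bot hm
  have hc : c ∈ circComplement R := by
    intro P hP hcP
    rw [IsDomain.minimalPrimes_eq_singleton_bot, Set.mem_singleton_iff] at hP
    rw [hP] at hcP
    exact hc0 hcP
  obtain ⟨e, θ, hθ, h1⟩ := h c hc
  cases e with
  | zero =>
    have := hθ c 1
    rw [pow_zero, pow_one, mul_one, h1] at this
    exact absurd (IsUnit.of_mul_eq_one _ this.symm) ((mem_maximalIdeal c).mp hcm)
  | succ e =>
    refine ⟨(θ.comp (AddMonoidHom.mulLeft c)).comp (iterateFrobenius R p e).toAddMonoidHom,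
      fun a x => ?_, by simpa using h1⟩
    have := hθ a (c * x ^ p ^ e)
    simp only [AddMonoidHom.comp_apply, AddMonoidHom.coe_mulLeft, RingHom.toAddMonoidHom_eq_coe,
      AddMonoidHom.coe_coe, iterateFrobenius_def, mul_pow]
    rw [← this]
    congr 1
    ring

/-- Descending chains of ideals containing a fixed power of the maximal ideal stabilize. -/
lemma exists_forall_ge_eq_of_pow_le [IsNoetherianRing R] (t : ℕ) (f : ℕ → Ideal R)
    (hf : Antitone f) (hle : ∀ e, maximalIdeal R ^ t ≤ f e) : ∃ n, ∀ e, n ≤ e → f e = f n := by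
  have hart : IsArtinianRing (R ⧸ maximalIdeal R ^ (t + 1)) :=
    quotient_artinian_of_mem_minimalPrimes_of_isLocalRing _
      ⟨⟨inferInstance, Ideal.pow_le_self (by lia)⟩, fun q hq _ => hq.1.le_of_pow_le hq.2⟩
  let g : ℕ →o (Ideal (R ⧸ maximalIdeal R ^ (t + 1)))ᵒᵈ :=
    ⟨fun e => OrderDual.toDual ((f e).map (Ideal.Quotient.mk _)),
      fun a b hab => Ideal.map_mono (hf hab)⟩
  obtain ⟨n, hn⟩ := IsArtinian.monotone_stabilizes g
  refine ⟨n, fun e he => ?_⟩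
  have hcomap : ∀ e, ((f e).map (Ideal.Quotient.mk (maximalIdeal R ^ (t + 1)))).comap
      (Ideal.Quotient.mk _) = f e := fun e => by
    rw [Ideal.comap_map_of_surjective _ Ideal.Quotient.mk_surjective, ← RingHom.ker_eq_comap_bot,
      Ideal.mk_ker, sup_eq_left]
    exact (Ideal.pow_le_pow_right (by lia)).trans (hle e)
  rw [← hcomap e, ← hcomap n]
  exact congrArg _ (hn e he).symm

/-- Chevalley's theorem for the splitting ideals of a strongly `F`-regular ring. -/
lemma IsStronglyFRegular.exists_frobeniusSplittingIdeal_le_pow [IsNoetherianRing R] [IsDomain R]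
    [Fact p.Prime] [CharP R p] (hff : IsFFinite R p) (hm : maximalIdeal R ≠ ⊥)
    (h : IsStronglyFRegular R p) (N : ℕ) :
    ∃ e, frobeniusSplittingIdeal R p e ≤ maximalIdeal R ^ N := by
  have hp2 : 2 ≤ p := (Fact.out : p.Prime).two_le
  set m := maximalIdeal R
  set I := frobeniusSplittingIdeal R p with hI
  have hanti : Antitone I := frobeniusSplittingIdeal_antitone (h.frobSplits_one hm)
  have hex : ∀ t, ∃ n, ∀ e, n ≤ e → I e ⊔ m ^ t = I n ⊔ m ^ t := fun t =>
    exists_forall_ge_eq_of_pow_le t (fun e => I e ⊔ m ^ t)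
      (fun a b hab => sup_le_sup_right (hanti hab) _) fun e => le_sup_right
  choose ε hε using hex
  set Q : ℕ → Ideal R := fun t => I (ε t) ⊔ m ^ t with hQdef
  obtain ⟨n, hn⟩ := exists_uniform_generators m Q (fun t => le_sup_right) (fun t t' htt' => by
    have h1 := hε t (max (ε t) (ε t')) (le_max_left _ _)
    have h2 := hε t' (max (ε t) (ε t')) (le_max_right _ _)
    simp only [hQdef]
    have h3 : m ^ t' ≤ m ^ t := Ideal.pow_le_pow_right htt'
    rw [← h1, ← h2, sup_assoc, sup_eq_right.mpr h3])
  obtain ⟨s, hs⟩ := hff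
  obtain ⟨c, hc0, k, g, θ, hθ, hsum⟩ := (frobenius R p).exists_mul_eq_sum_of_finite
    ((frobenius R p).finite_of_forall_eq_sum s hs)
  have hθlin : ∀ i, IsFrobLinear p 1 (θ i) := fun i a x => by
    rw [pow_one]
    exact hθ i a x
  obtain ⟨e₁, he₁⟩ := h ((c ^ p) ^ n) (fun P hP hcP => by
    rw [IsDomain.minimalPrimes_eq_singleton_bot, Set.mem_singleton_iff] at hP
    rw [hP] at hcP
    exact pow_ne_zero _ (pow_ne_zero _ hc0) hcP)
  obtain ⟨T₁, hT₁⟩ := IsFrobLinear.exists_apply_mem_pow (R := R) (p := p) e₁ 1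
  obtain ⟨T₂, hT₂⟩ := IsFrobLinear.exists_apply_mem_pow (R := R) (p := p) e₁ N
  set t := max (max T₁ T₂) N with ht
  have hmT₁ : m ^ t ≤ I e₁ := fun x hx η hη => by
    simpa using hT₁ η hη x (Ideal.pow_le_pow_right (by lia) hx)
  have hQI : Q t ≤ I e₁ := by
    have : Q t = I (max (ε t) e₁) ⊔ m ^ t := (hε t _ (le_max_left _ _)).symm
    rw [this]
    exact sup_le (hanti (le_max_right _ _)) hmT₁
  obtain ⟨r, hrQ, hQr⟩ := hn t
  obtain ⟨d, hd, hdr⟩ := exists_sub_pow_mem_and_mul_mem r (c ^ p) (m ^ t) fun i => by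
    set J := Ideal.span (Set.range r) with hJ
    have hri : r i ∈ I (ε t + 1) ⊔ m ^ t := by
      rw [hε t (ε t + 1) (by lia)]
      exact hrQ i
    obtain ⟨y, hy, z, hz, hyz⟩ := Submodule.mem_sup.mp hri
    rw [← hyz, mul_add]
    refine add_mem ?_ (Ideal.mem_sup_right (Ideal.mul_mem_left _ _ hz))
    have := hsum y
    rw [frobenius_def] at this
    rw [this]
    refine sum_mem fun j _ => Ideal.mul_mem_right _ _ ?_
    obtain ⟨u, hu, v, hv, huv⟩ := Submodule.mem_sup.mp
      (hQr (Ideal.mem_sup_left ((hθlin j).apply_mem_frobeniusSplittingIdeal hy)))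
    rw [← huv, map_add, frobenius_def, frobenius_def]
    refine add_mem (Ideal.mem_sup_left ?_) (Ideal.mem_sup_right ?_)
    · rw [← pow_two]
      exact Ideal.pow_le_pow_right hp2 (Ideal.pow_mem_pow hu p)
    · exact Ideal.pow_mem_of_mem _ hv p (by lia)
  have hJQ : Ideal.span (Set.range r) ≤ Q t := by
    rw [Ideal.span_le]
    rintro _ ⟨i, rfl⟩
    exact hrQ i
  have hdI : d ∉ I e₁ := fun hdI => by
    have h1 : (c ^ p) ^ n ∈ I e₁ := by
      simpa using sub_mem hdI (hQI (hJQ hd))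
    exact mem_frobeniusSplittingIdeal_iff.mp h1 he₁
  rw [hI, mem_frobeniusSplittingIdeal_iff, not_not] at hdI
  obtain ⟨η, hη, hη1⟩ := hdI
  have hJN : Ideal.span (Set.range r) ≤ m ^ N := by
    rw [Ideal.span_le]
    rintro _ ⟨i, rfl⟩
    have : r i = η (d * (r i) ^ p ^ e₁) := by
      rw [mul_comm, hη, hη1, mul_one]
    rw [this]
    refine hT₂ η hη _ (Ideal.pow_le_pow_right (show T₂ ≤ t by lia) ?_)
    rw [← Nat.succ_pred_eq_of_ne_zero (pow_ne_zero e₁ (by lia : p ≠ 0)), pow_succ', ← mul_assoc]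
    exact Ideal.mul_mem_right _ _ (hdr i)
  refine ⟨ε t, le_sup_left.trans (hQr.trans (sup_le hJN (Ideal.pow_le_pow_right (by lia))))⟩

end

/-- If `(R,m) → (B,n_B)` is a flat local homomorphism of F-finite reduced Noetherian
local rings of prime characteristic `p` with `mB = n_B` and `R` is strongly F-regular,
then `B` is strongly F-regular. -/
theorem stronglyFRegular_of_flat_of_field_fiber
    (p : ℕ) [Fact p.Prime]
    (R B : Type*) [CommRing R] [CommRing B]
    [IsNoetherianRing R] [IsNoetherianRing B]
    [IsLocalRing R] [IsLocalRing B] [CharP R p] [CharP B p]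
    [IsReduced R] [IsReduced B] (hffR : IsFFinite R p) (hffB : IsFFinite B p)
    [Algebra R B] [Module.Flat R B] [IsLocalHom (algebraMap R B)]
    (hfiber : Ideal.map (algebraMap R B) (IsLocalRing.maximalIdeal R) =
      IsLocalRing.maximalIdeal B)
    (hSFR : IsStronglyFRegular R p) :
    IsStronglyFRegular B p := by
  have hcommF : ∀ e, (algebraMap R B).comp (iterateFrobenius R p e) =
      (iterateFrobenius B p e).comp (algebraMap R B) := fun e =>
    RingHom.ext fun x => RingHom.map_iterateFrobenius _ p x e
  have hp0 : p ≠ 0 := (Fact.out : p.Prime).ne_zero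
  have hR : IsDomain R := hSFR.isDomain hp0
  intro c hc
  have hc0 : c ≠ 0 := by
    rintro rfl
    obtain ⟨P, hP, -⟩ := Ideal.exists_minimalPrimes_le (bot_le : ⊥ ≤ maximalIdeal B)
    exact hc P hP P.zero_mem
  by_cases hm : maximalIdeal R = ⊥
  · rw [hm, Ideal.map_bot] at hfiber
    have hcu : IsUnit c := by
      by_contra hcu
      have : c ∈ maximalIdeal B := hcu
      rw [← hfiber] at this
      exact hc0 this
    obtain ⟨u, rfl⟩ := hcu
    refine ⟨0, AddMonoidHom.mulLeft (↑u⁻¹ : B), fun a x => ?_, by simp⟩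
    simp only [AddMonoidHom.coe_mulLeft, pow_zero, pow_one]
    rw [mul_left_comm]
  obtain ⟨N, hN⟩ : ∃ N, c ∉ maximalIdeal B ^ N := by
    by_contra! hall
    have : c ∈ ⨅ N, maximalIdeal B ^ N := by
      rw [Ideal.mem_iInf]
      exact hall
    rw [Ideal.iInf_pow_eq_bot_of_isLocalRing _ (maximalIdeal.isMaximal B).ne_top] at this
    exact hc0 this
  obtain ⟨e, he⟩ := hSFR.exists_frobeniusSplittingIdeal_le_pow hffR hm N
  obtain ⟨s, hs⟩ := hffB
  have hflat : (algebraMap R B).Flat := RingHom.flat_algebraMap_iff.mpr inferInstance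
  refine ⟨e, exists_addMonoidHom_of_flat (algebraMap R B) (algebraMap R B)
    (iterateFrobenius R p e) (iterateFrobenius B p e) (hcommF e) hflat hflat
    (RingHom.Finite.iterateFrobenius_of_forall_eq_sum p s hs e) hfiber c
    (frobeniusSplittingIdeal R p e) (fun r hr => mem_frobeniusSplittingIdeal_iff.mpr hr) ?_⟩
  intro hmem
  refine hN ?_
  rw [← hfiber, ← Ideal.map_pow]
  exact Ideal.map_mono he hmem
end
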